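/- arXiv:1905.12664 — 2 statements merged into one kernel-verified Lean document; each statement's English description precedes it below -/
import Mathlib

section
/- Let A be a commutative ring, M and N be A-modules, and a ∈ Ann(N) an element that is both A-regular and M-regular (a nonzerodivisor on A and on M). Then for every i ∈ ℕ there is an isomorphism Ext^i_A(M, N) ≅ Ext^i_{A/aA}(M/aM, N). -/
open CategoryTheory Opposite

/-- The Ext modules `Ext^i_R(M, N)`. -/
noncomputable def extMod (R : Type) [CommRing R] (i : ℕ) (M N : Type) [AddCommGroup M]
    [Module R M] [AddCommGroup N] [Module R N] : ModuleCat R :=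
  ((Ext R (ModuleCat R) i).obj (op (ModuleCat.of R M))).obj (ModuleCat.of R N)

open scoped TensorProduct

universe u

namespace CategoryTheory.ProjectiveResolution

variable {C : Type*} [Category* C] [Abelian C]

/-- The projective resolution given by a complex of projectives and an augmentation. -/
noncomputable def ofAugmentation {Z : C} (K : ChainComplex C ℕ) (hK : ∀ n, Projective (K.X n))
    (ε : K.X 0 ⟶ Z) (hε : K.d 1 0 ≫ ε = 0) (hepi : Epi ε)
    (hexact₀ : (ShortComplex.mk _ _ hε).Exact) (hexact : ∀ n, K.ExactAt (n + 1)) :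
    ProjectiveResolution Z where
  complex := K
  projective := hK
  π := (ChainComplex.toSingle₀Equiv _ _).symm ⟨ε, hε⟩
  quasiIso := ⟨fun n => by
    cases n
    · rw [ChainComplex.quasiIsoAt₀_iff, ShortComplex.quasiIso_iff_of_zeros' _
        (K.shape 0 0 (by simp)) rfl rfl]
      refine (ShortComplex.exact_and_epi_g_iff_of_iso ?_).2 ⟨hexact₀, hepi⟩
      exact ShortComplex.isoMk (Iso.refl _) (Iso.refl _) (Iso.refl _)
        ((Category.id_comp _).trans (Category.comp_id _).symm)
        ((Category.id_comp _).trans ((ChainComplex.toSingle₀Equiv_symm_apply_f_zero ε hε).symm.trans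
          (Category.comp_id _).symm))
    · rw [quasiIsoAt_iff_exactAt']
      · apply hexact
      · apply ChainComplex.exactAt_succ_single_obj⟩

end CategoryTheory.ProjectiveResolution

namespace ModuleCat

variable {R S : Type u} [CommRing R] [CommRing S] (f : R →+* S)

instance : (extendScalars.{u, u, u} f).Additive :=
  (extendRestrictScalarsAdj f).left_adjoint_additive

/-- An additive equivalence commuting with scalars is an isomorphism of modules. -/
def isoOfAddEquiv {X Y : ModuleCat.{u} R} (e : X ≃+ Y)
    (he : ∀ (r : R) (x : X), e (r • x) = r • e x) : X ≅ Y :=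
  (e.toLinearEquiv he).toModuleIso

/-- The adjunction between extension and restriction of scalars, as an isomorphism of modules. -/
noncomputable def extendScalarsHomIso (X : ModuleCat.{u} R) (N : ModuleCat.{u} S) :
    (restrictScalars f).obj (of S ((extendScalars f).obj X ⟶ N)) ≅
      of R (X ⟶ (restrictScalars f).obj N) :=
  isoOfAddEquiv ((extendRestrictScalarsAdj f).homAddEquiv X N) fun _ _ => rfl

/-- The base change of a chain complex of modules. -/
noncomputable abbrev extendScalarsComplex (P : ChainComplex (ModuleCat.{u} R) ℕ) :
    ChainComplex (ModuleCat.{u} S) ℕ :=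
  ((extendScalars f).mapHomologicalComplex _).obj P

/-- Homomorphisms out of the base change of a complex agree with the homomorphisms out of it into
the restriction of scalars. -/
noncomputable def linearYonedaObjExtendScalarsIso (P : ChainComplex (ModuleCat.{u} R) ℕ)
    (N : ModuleCat.{u} S) :
    ((restrictScalars f).mapHomologicalComplex _).obj
        ((extendScalarsComplex f P).linearYonedaObj S N) ≅
      P.linearYonedaObj R ((restrictScalars f).obj N) :=
  HomologicalComplex.Hom.isoOfComponents (fun n => extendScalarsHomIso f (P.X n) N) (by
    intro i j _
    ext φ
    exact ((extendRestrictScalarsAdj f).homEquiv_naturality_left (P.d j i) φ).symm)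

/-- The cohomology of the complex of homomorphisms out of the base change of a complex agrees with
that of the homomorphisms out of it into the restriction of scalars. -/
noncomputable def homologyLinearYonedaObjExtendScalarsIso (P : ChainComplex (ModuleCat.{u} R) ℕ)
    (N : ModuleCat.{u} S) (i : ℕ) :
    (restrictScalars f).obj (((extendScalarsComplex f P).linearYonedaObj S N).homology i) ≅
      (P.linearYonedaObj R ((restrictScalars f).obj N)).homology i :=
  ((((extendScalarsComplex f P).linearYonedaObj S N).sc i).mapHomologyIso
      (restrictScalars f)).symm ≪≫
    HomologicalComplex.homologyMapIso (linearYonedaObjExtendScalarsIso f P N) i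

/-- The base change of a projective resolution that remains exact in positive degrees. -/
noncomputable def extendScalarsProjectiveResolution {M : ModuleCat.{u} R}
    (P : ProjectiveResolution M) (hP : ∀ n, (extendScalarsComplex f P.complex).ExactAt (n + 1)) :
    ProjectiveResolution ((extendScalars.{u, u, u} f).obj M) :=
  let ε : P.complex.X 0 ⟶ M := P.π.f 0
  have hε : P.complex.d 1 0 ≫ ε = 0 := P.complex_d_comp_π_f_zero
  have hepi : Epi ε := inferInstanceAs (Epi (P.π.f 0))
  have : (extendScalars.{u, u, u} f).PreservesEpimorphisms :=
    Functor.preservesEpimorphisms_of_adjunction (extendRestrictScalarsAdj f)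
  .ofAugmentation (extendScalarsComplex f P.complex)
    (fun n => (extendRestrictScalarsAdj f).map_projective _ (P.projective n))
    ((extendScalars f).map ε)
    (((extendScalars f).map_comp _ _).symm.trans
      ((congrArg _ hε).trans (Functor.map_zero _ _ _)))
    ((extendScalars f).map_epi ε)
    (ShortComplex.Exact.map_of_epi_of_preservesCokernel (S := ShortComplex.mk _ _ hε)
      P.exact₀ (extendScalars f) hepi inferInstance)
    hP

end ModuleCat

section Quotient

variable {A : Type u} [CommRing A] {a : A}

lemma one_tmul_surjective (X : Type u) [AddCommGroup X] [Module A X] :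
    Function.Surjective fun x : X => (1 : A ⧸ Ideal.span {a}) ⊗ₜ[A] x :=
  TensorProduct.mk_surjective A X (A ⧸ Ideal.span {a}) Ideal.Quotient.mk_surjective

lemma one_tmul_eq_zero_iff {X : Type u} [AddCommGroup X] [Module A X] (x : X) :
    (1 : A ⧸ Ideal.span {a}) ⊗ₜ[A] x = 0 ↔ ∃ y : X, a • y = x := by
  have h := TensorProduct.quotTensorEquivQuotSMul_mk_tmul (Ideal.span {a}) (1 : A) x
  rw [map_one, one_smul] at h
  rw [← (TensorProduct.quotTensorEquivQuotSMul X (Ideal.span {a})).map_eq_zero_iff, h,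
    Submodule.Quotient.mk_eq_zero, Submodule.ideal_span_singleton_smul,
    Submodule.mem_smul_pointwise_iff_exists]
  simp

/-- Reduction modulo an `A`-regular and `M`-regular element keeps a projective resolution of `M`
exact in positive degrees. -/
lemma exactAt_extendScalarsComplex_quotient {M : ModuleCat.{u} A} (hA : a ∈ nonZeroDivisors A)
    (hM : IsSMulRegular M a) (P : ProjectiveResolution M) (n : ℕ) :
    (ModuleCat.extendScalarsComplex (Ideal.Quotient.mk (Ideal.span {a})) P.complex).ExactAt
      (n + 1) := by
  have hreg (k : ℕ) : IsSMulRegular (P.complex.X k) a := by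
    have := (IsProjective.iff_projective (P.complex.X k)).2 (P.projective k)
    exact Module.Flat.isSMulRegular_of_nonZeroDivisors hA
  rw [HomologicalComplex.exactAt_iff' _ (n + 2) (n + 1) n (by simp) (by simp),
    ShortComplex.moduleCat_exact_iff]
  intro t ht
  obtain ⟨x, rfl⟩ := one_tmul_surjective (a := a) (P.complex.X (n + 1)) t
  obtain ⟨y, hy⟩ := (one_tmul_eq_zero_iff (a := a) (P.complex.d (n + 1) n x)).1 ht
  have hdd (k : ℕ) (z : P.complex.X (k + 2)) :
      P.complex.d (k + 1) k (P.complex.d (k + 2) (k + 1) z) = 0 :=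
    ConcreteCategory.congr_hom (P.complex.d_comp_d (k + 2) (k + 1) k) z
  have hex (k : ℕ) := (ShortComplex.moduleCat_exact_iff _).1 (P.exact_succ k)
  obtain ⟨z, hz⟩ : ∃ z, P.complex.d (n + 1) n z = y := by
    cases n with
    | zero =>
      refine (ShortComplex.moduleCat_exact_iff _).1 P.exact₀ y (hM ?_)
      have : P.π.f 0 (P.complex.d 1 0 x) = 0 :=
        ConcreteCategory.congr_hom P.complex_d_comp_π_f_zero x
      rw [← hy, map_smul] at this
      exact this.trans (smul_zero a).symm
    | succ k =>
      refine hex k y (hreg k ?_)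
      have := hdd k x
      rw [← hy, map_smul] at this
      exact this.trans (smul_zero a).symm
  obtain ⟨w, hw⟩ := hex n (x - a • z) (by
    change P.complex.d (n + 1) n (x - a • z) = 0
    rw [map_sub, map_smul, hz, hy, sub_self])
  refine ⟨(1 : A ⧸ Ideal.span {a}) ⊗ₜ[A] w, ?_⟩
  change (1 : A ⧸ Ideal.span {a}) ⊗ₜ[A] (P.complex.d (n + 2) (n + 1) w) =
    (1 : A ⧸ Ideal.span {a}) ⊗ₜ[A] x
  have hw' : P.complex.d (n + 2) (n + 1) w = x - a • z := hw
  rw [hw', TensorProduct.tmul_sub, (one_tmul_eq_zero_iff (a • z)).2 ⟨z, rfl⟩, sub_zero]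

end Quotient

/-- Let `A` be a commutative ring, `M` and `N` be `A`-modules, and `a ∈ Ann(N)` an element
that is both `A`-regular and `M`-regular.  Then for every `i ∈ ℕ` there is an isomorphism
`Ext^i_A(M, N) ≅ Ext^i_{A/aA}(M/aM, N)`.  Here `N` is an `A/aA`-module since `a`
annihilates it (this module structure, compatible with the `A`-action, is part of the data),
and `M/aM = M ⧸ (a)M` is an `A/aA`-module. -/
theorem ext_iso_of_regular_annihilating
    (A M N : Type) [CommRing A] [AddCommGroup M] [Module A M] [AddCommGroup N] [Module A N]
    (a : A)
    [Module (A ⧸ Ideal.span {a}) N] [IsScalarTower A (A ⧸ Ideal.span {a}) N]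
    (ha : a ∈ Module.annihilator A N)
    (hAreg : a ∈ nonZeroDivisors A)
    (hMreg : IsSMulRegular M a) (i : ℕ) :
    Nonempty ((extMod A i M N) ≃+
      (extMod (A ⧸ Ideal.span {a}) i
        (M ⧸ (Ideal.span {a} • ⊤ : Submodule A M)) N)) := by
  let f := Ideal.Quotient.mk (Ideal.span {a})
  let P := ProjectiveResolution.of (ModuleCat.of A M)
  let Q := ModuleCat.extendScalarsProjectiveResolution f P
    (exactAt_extendScalarsComplex_quotient hAreg hMreg P)
  let B := A ⧸ Ideal.span {a}
  let e : B ⊗[A] M ≃ₗ[B] M ⧸ (Ideal.span {a} • ⊤ : Submodule A M) :=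
    (TensorProduct.quotTensorEquivQuotSMul M (Ideal.span {a})).extendScalarsOfSurjective
      Ideal.Quotient.mk_surjective
  let eM : (ModuleCat.extendScalars f).obj (ModuleCat.of A M) ≅
      ModuleCat.of B (M ⧸ (Ideal.span {a} • ⊤ : Submodule A M)) := e.toModuleIso
  let eN : (ModuleCat.restrictScalars f).obj (ModuleCat.of B N) ≅ ModuleCat.of A N :=
    ModuleCat.isoOfAddEquiv (AddEquiv.refl N) fun r n => algebraMap_smul B r (show N from n)
  have e₁ := ((Ext A (ModuleCat A) i).obj (op (ModuleCat.of A M))).mapIso eN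
  have e₂ := P.isoExt (R := A) i ((ModuleCat.restrictScalars f).obj (ModuleCat.of B N))
  have e₃ := ModuleCat.homologyLinearYonedaObjExtendScalarsIso f P.complex (ModuleCat.of B N) i
  have e₄ := Q.isoExt (R := B) i (ModuleCat.of B N)
  have e₅ := ((Ext B (ModuleCat B) i).mapIso eM.op).app (ModuleCat.of B N)
  let C := (ModuleCat.extendScalarsComplex f P.complex).linearYonedaObj B (ModuleCat.of B N)
  have eRight : (C.homology i : Type) ≃+
      (P.complex.linearYonedaObj A
        ((ModuleCat.restrictScalars f).obj (ModuleCat.of B N))).homology i :=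
    e₃.toLinearEquiv.toAddEquiv
  have eLeft : extMod B i (M ⧸ (Ideal.span {a} • ⊤ : Submodule A M)) N ≅ C.homology i :=
    e₅ ≪≫ e₄
  exact ⟨((e₁.symm ≪≫ e₂).toLinearEquiv.toAddEquiv.trans eRight.symm).trans
    eLeft.toLinearEquiv.toAddEquiv.symm⟩
end

section
/- Let Δ be a 2-dimensional simplicial complex on vertex set [n] such that the first simplicial homology H₁(Δ; K) with coefficients in the field K vanishes. Then the Stanley–Reisner ring K[Δ] = R/I_Δ is canonically Cohen–Macaulay, i.e. Ext^{n−3}_R(K[Δ], ω_R) is a Cohen–Macaulay R-module. -/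
open CategoryTheory Opposite MvPolynomial

/-- The Krull dimension of a module: `dim M = dim R/Ann(M)`. -/
noncomputable def moduleDim (R : Type) [CommRing R] (M : Type) [AddCommGroup M] [Module R M] :
    WithBot (WithTop ℕ) :=
  ringKrullDim (R ⧸ Module.annihilator R M)

/-- The depth of `M` with respect to the ideal `I`: the supremum of the lengths of
`M`-regular sequences contained in `I`. -/
noncomputable def moduleDepth {R : Type} [CommRing R] (I : Ideal R) (M : Type) [AddCommGroup M]
    [Module R M] : WithTop ℕ :=
  sSup {m : WithTop ℕ | ∃ rs : List R, (rs.length : WithTop ℕ) = m ∧ (∀ r ∈ rs, r ∈ I) ∧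
    RingTheory.Sequence.IsRegular M rs}

/-- `M` is a Cohen–Macaulay module (w.r.t. the distinguished ideal `I`): depth equals
Krull dimension. -/
def IsCMMod {R : Type} [CommRing R] (I : Ideal R) (M : Type) [AddCommGroup M] [Module R M] :
    Prop :=
  (moduleDepth I M : WithBot (WithTop ℕ)) = moduleDim R M

/-- The graded maximal ideal `𝔪 = (x₁, …, xₙ)` of `R = K[x₁,…,xₙ]`. -/
noncomputable def maxIdeal (K : Type) [Field K] (n : ℕ) : Ideal (MvPolynomial (Fin n) K) :=
  Ideal.span (Set.range (MvPolynomial.X : Fin n → MvPolynomial (Fin n) K))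

attribute [local instance] MvPolynomial.gradedAlgebra

open MvPolynomial

/-- `Δ` is an (abstract) simplicial complex on the vertex set `Fin n`:
a collection of finite sets closed under taking subsets. -/
def IsSimplicialComplex {n : ℕ} (Δ : Finset (Finset (Fin n))) : Prop :=
  ∀ s ∈ Δ, ∀ t ⊆ s, t ∈ Δ

/-- The Stanley–Reisner ideal `I_Δ` of `Δ`, generated by the squarefree monomials
corresponding to non-faces of `Δ`. -/
noncomputable def stanleyReisnerIdeal (K : Type) [Field K] {n : ℕ}
    (Δ : Finset (Finset (Fin n))) : Ideal (MvPolynomial (Fin n) K) :=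
  Ideal.span {m | ∃ S : Finset (Fin n), S ∉ Δ ∧ m = ∏ i ∈ S, (MvPolynomial.X i : MvPolynomial (Fin n) K)}

/-- The space of simplicial `k`-chains of `Δ` with coefficients in `K`:
functions on the `k`-dimensional faces (faces with `k+1` vertices). -/
abbrev simpChains (K : Type) [Field K] {n : ℕ} (Δ : Finset (Finset (Fin n))) (k : ℕ) : Type :=
  {s : Finset (Fin n) // s ∈ Δ ∧ s.card = k + 1} → K

/-- The simplicial boundary map `∂ : C_{k+1}(Δ; K) → C_k(Δ; K)`, with the standard signs
coming from the linear order on the vertices. -/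
noncomputable def simpBoundary (K : Type) [Field K] {n : ℕ} (Δ : Finset (Finset (Fin n)))
    (k : ℕ) : simpChains K Δ (k + 1) →ₗ[K] simpChains K Δ k where
  toFun c s := ∑ v : Fin n,
    if h : v ∉ s.1 ∧ insert v s.1 ∈ Δ ∧ (insert v s.1).card = (k + 1) + 1
      then ((-1 : K)) ^ ((s.1.filter (fun i => i < v)).card) * c ⟨insert v s.1, h.2⟩
      else 0
  map_add' c c' := by
    funext s
    rw [Pi.add_apply, ← Finset.sum_add_distrib]
    refine Finset.sum_congr rfl fun v _ => ?_
    split_ifs with h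
    · simp [mul_add]
    · simp
  map_smul' a c := by
    funext s
    simp only [RingHom.id_apply, Pi.smul_apply, Finset.smul_sum]
    refine Finset.sum_congr rfl fun v _ => ?_
    split_ifs with h
    · simp [smul_eq_mul]; ring
    · simp

/-- The reduced simplicial homology `H_{j+1}(Δ; K)` (for homological degrees `≥ 1`,
reduced and ordinary homology agree): cycles in degree `j+1` modulo boundaries. -/
noncomputable abbrev simpHomologySucc (K : Type) [Field K] {n : ℕ} (Δ : Finset (Finset (Fin n)))
    (j : ℕ) : Type :=
  ↥(LinearMap.ker (simpBoundary K Δ j)) ⧸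
    Submodule.comap (LinearMap.ker (simpBoundary K Δ j)).subtype
      (LinearMap.range (simpBoundary K Δ (j + 1)))

section ExtComparison

/-- The homology of a short complex of modules, computed from a surjection of the cycles whose
kernel consists of the boundaries. -/
noncomputable def CategoryTheory.ShortComplex.homologyLinearEquivOfSurjective {R : Type}
    [CommRing R] (S : ShortComplex (ModuleCat.{0} R)) {A : Type} [AddCommGroup A] [Module R A]
    (ψ : LinearMap.ker S.g.hom →ₗ[R] A) (hψ : Function.Surjective ψ)
    (hker : ∀ x, ψ x = 0 ↔ ∃ y, S.f y = x.1) : S.homology ≃ₗ[R] A :=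
  have hr : LinearMap.range S.moduleCatToCycles = LinearMap.ker ψ := by
    ext x
    rw [LinearMap.mem_range, LinearMap.mem_ker, hker]
    exact exists_congr fun y => Subtype.ext_iff
  S.moduleCatHomologyIso.toLinearEquiv.trans
    ((Submodule.quotEquivOfEq _ _ hr).trans (ψ.quotKerEquivOfSurjective hψ))

/-- The homology of a cochain complex of modules, computed from a surjection of the cocycles whose
kernel consists of the coboundaries. -/
noncomputable def CochainComplex.homologyLinearEquivOfSurjective {R : Type} [CommRing R]
    (C : CochainComplex (ModuleCat.{0} R) ℕ) (n : ℕ) {A : Type} [AddCommGroup A] [Module R A]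
    (ψ : LinearMap.ker (C.d n (n + 1)).hom →ₗ[R] A) (hψ : Function.Surjective ψ)
    (hker : ∀ x, ψ x = 0 ↔ ∃ m, ∃ y : C.X m, C.d m n y = x.1) :
    C.homology n ≃ₗ[R] A :=
  (C.homologyIsoSc' _ n (n + 1) rfl (by simp)).toLinearEquiv.trans
    ((C.sc' ((ComplexShape.up ℕ).prev n) n (n + 1)).homologyLinearEquivOfSurjective ψ hψ <| by
      intro x
      refine (hker x).trans ⟨?_, fun ⟨y, hy⟩ => ⟨_, y, hy⟩⟩
      rintro ⟨m, y, hy⟩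
      by_cases hm : (ComplexShape.up ℕ).Rel m n
      · obtain rfl := (ComplexShape.up ℕ).prev_eq' hm
        exact ⟨y, hy⟩
      · rw [C.shape _ _ hm] at hy
        exact ⟨0, (map_zero _).trans hy⟩)

lemma CategoryTheory.ProjectiveResolution.extMk_eq_zero_iff_of_zero {C : Type*} [Category C]
    [Abelian C] [HasExt.{0} C] {X Y : C}
    (P : ProjectiveResolution X) (f : P.complex.X 0 ⟶ Y) (m : ℕ) (hm : 0 + 1 = m)
    (hf : P.complex.d m 0 ≫ f = 0) :
    P.extMk f m hm hf = 0 ↔ f = 0 := by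
  refine ⟨fun h => ?_, ?_⟩
  · rw [← P.extEquivCohomologyClass.apply_eq_iff_eq,
      extEquivCohomologyClass_extMk, extEquivCohomologyClass_zero,
      CochainComplex.HomComplex.CohomologyClass.mk_eq_zero_iff,
      CochainComplex.HomComplex.Cocycle.toSingleMk_mem_coboundaries_iff _ _ _ _ _ 1 (by lia)] at h
    obtain ⟨g, hg⟩ := h
    have hz : Limits.IsZero (P.cochainComplex.X 1) :=
      P.cochainComplex.isZero_of_isStrictlyLE 0 1
    rw [hz.eq_of_src g 0, Limits.comp_zero] at hg
    rw [← cancel_epi (P.cochainComplexXIso (-(0 : ℕ)) 0 rfl).hom]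
    simpa using hg.symm
  · rintro rfl
    exact P.extMk_zero _ _

/-- The `Ext` modules defined by left derived functors agree with those of the derived category. -/
noncomputable def extModEquiv (R : Type) [CommRing R] (i : ℕ) (M N : Type) [AddCommGroup M]
    [Module R M] [AddCommGroup N] [Module R N] :
    extMod R i M N ≃ₗ[R] Abelian.Ext.{0} (ModuleCat.of R M) (ModuleCat.of R N) i := by
  let P := projectiveResolution (ModuleCat.of R M)
  let Y := ModuleCat.of R N
  let C := P.complex.linearYonedaObj R Y
  refine (P.isoExt i Y).toLinearEquiv.trans (C.homologyLinearEquivOfSurjective i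
    { toFun := fun x => P.extMk (Y := Y) x.1 (i + 1) rfl x.2
      map_add' := fun x y => (P.add_extMk _ _ _ _ _ _).symm
      map_smul' := fun r x => ?_ } ?_ ?_)
  · refine Eq.trans ?_ (Abelian.Ext.smul_eq_comp_mk₀ (X := ModuleCat.of R M) (Y := Y) _ r).symm
    refine Eq.trans ?_ (P.extMk_comp_mk₀ (Y := Y) x.1 (i + 1) rfl x.2 (r • 𝟙 Y)).symm
    congr 1
  · intro α
    obtain ⟨f, hf, rfl⟩ := P.extMk_surjective α (i + 1) rfl
    exact ⟨⟨f, hf⟩, rfl⟩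
  · rintro ⟨f, hf⟩
    cases i with
    | zero =>
      refine (P.extMk_eq_zero_iff_of_zero (Y := Y) f _ rfl hf).trans ⟨fun h => ⟨0, 0, ?_⟩, ?_⟩
      · rw [map_zero]; exact h.symm
      · rintro ⟨m, y, hy⟩
        rw [C.shape m 0 (by simp)] at hy
        exact hy.symm
    | succ i =>
      refine (P.extMk_eq_zero_iff (Y := Y) f _ rfl hf i rfl).trans ⟨?_, ?_⟩
      · rintro ⟨g, hg⟩
        exact ⟨i, g, hg⟩
      · rintro ⟨m, y, hy⟩
        by_cases hm : m + 1 = i + 1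
        · obtain rfl : m = i := by lia
          exact ⟨y, hy⟩
        · rw [C.shape m (i + 1) hm] at hy
          exact ⟨0, by rw [Limits.comp_zero]; exact hy⟩

end ExtComparison

section DimensionShift

open Abelian

variable {R : Type} [CommRing R]

/-- Dimension shifting: if `Ext^i(M, E) = Ext^{i+1}(M, E) = 0` for the middle term `E` of a short
exact sequence `0 → A → E → B → 0`, then `Ext^{i+1}(M, A) ≅ Ext^i(M, B)`. -/
theorem nonempty_ext_linearEquiv_of_exact {A E B : Type} [AddCommGroup A] [Module R A]
    [AddCommGroup E] [Module R E] [AddCommGroup B] [Module R B] (M : ModuleCat.{0} R) (i : ℕ)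
    (f : A →ₗ[R] E) (g : E →ₗ[R] B) (hf : Function.Injective f) (hg : Function.Surjective g)
    (hfg : Function.Exact f g)
    (h₀ : Subsingleton (Ext.{0} M (ModuleCat.of R E) i))
    (h₁ : Subsingleton (Ext.{0} M (ModuleCat.of R E) (i + 1))) :
    Nonempty (Ext.{0} M (ModuleCat.of R A) (i + 1) ≃ₗ[R] Ext.{0} M (ModuleCat.of R B) i) := by
  let S : ShortComplex (ModuleCat.{0} R) :=
    ShortComplex.mk (ModuleCat.ofHom f) (ModuleCat.ofHom g) (by
      ext x
      exact hfg.apply_apply_eq_zero x)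
  have hS : S.ShortExact :=
    { exact := (ShortComplex.ShortExact.moduleCat_exact_iff_function_exact S).2 hfg
      mono_f := (ModuleCat.mono_iff_injective _).2 hf
      epi_g := (ModuleCat.epi_iff_surjective _).2 hg }
  refine ⟨(LinearEquiv.ofBijective (hS.extClass.postcompOfLinear R M (rfl : i + 1 = i + 1))
    ⟨?_, ?_⟩).symm⟩
  · refine (injective_iff_map_eq_zero _).2 fun x hx => ?_
    obtain ⟨y, rfl⟩ := Ext.covariant_sequence_exact₃ M hS x rfl hx
    rw [@Subsingleton.elim _ h₀ y 0, Ext.zero_comp]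
  · intro x
    exact Ext.covariant_sequence_exact₁ M hS x (@Subsingleton.elim _ h₁ _ _) rfl

/-- If the identity of `E` is a sum of endomorphisms divisible by elements which annihilate `M`,
then `Ext^i(M, E) = 0`. -/
theorem subsingleton_ext_of_sum_smul_eq_id {M E ι : Type} [Fintype ι] [AddCommGroup M] [Module R M]
    [AddCommGroup E] [Module R E] (i : ℕ) (r : ι → R) (θ : ι → E →ₗ[R] E)
    (hr : ∀ j, r j ∈ Module.annihilator R M) (hθ : ∑ j, r j • θ j = LinearMap.id) :
    Subsingleton (Ext.{0} (ModuleCat.of R M) (ModuleCat.of R E) i) := by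
  refine ⟨fun a b => ?_⟩
  suffices h : ∀ a : Ext.{0} (ModuleCat.of R M) (ModuleCat.of R E) i, a = 0 by rw [h a, h b]
  intro a
  have h1 : a = a.comp (Ext.mk₀ (𝟙 _)) (add_zero i) := (Ext.comp_mk₀_id a).symm
  have h2 : (𝟙 (ModuleCat.of R E)) = ∑ j, r j • ModuleCat.ofHom (θ j) := by
    ext x
    have := LinearMap.congr_fun hθ x
    simpa using this.symm
  have h3 : ∀ j, r j • a = 0 := by
    intro j
    have h4 : r j • 𝟙 (ModuleCat.of R M) = 0 := by
      ext x
      simpa using Module.mem_annihilator.1 (hr j) x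
    calc r j • a = ((r j • Ext.mk₀ (𝟙 _)).comp a (zero_add i)) := by
          rw [Ext.smul_comp, Ext.mk₀_id_comp]
      _ = 0 := by rw [← Ext.mk₀_smul, h4, Ext.mk₀_zero, Ext.zero_comp]
  rw [h1, h2, Ext.mk₀_sum, Ext.comp_sum]
  refine Finset.sum_eq_zero fun j _ => ?_
  rw [Ext.mk₀_smul, Ext.comp_smul, ← Ext.smul_comp, h3 j, Ext.zero_comp]

end DimensionShift

section Boundary

variable {n : ℕ}

/-- The sign `(-1)^{#{i ∈ G : i < v}}` of inserting the vertex `v` into `G`. -/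
def insertSign (v : Fin n) (G : Finset (Fin n)) : ℤ :=
  (-1) ^ (G.filter (fun i => i < v)).card

lemma insertSign_mul_self (v : Fin n) (G : Finset (Fin n)) :
    insertSign v G * insertSign v G = 1 := by
  rw [insertSign, ← mul_pow]
  simp

lemma insertSign_insert {v w : Fin n} {G : Finset (Fin n)} (hw : w ∉ G) :
    insertSign v (insert w G) = if w < v then -insertSign v G else insertSign v G := by
  simp only [insertSign, Finset.filter_insert]
  split_ifs with h
  · rw [Finset.card_insert_of_notMem (by simp [hw]), pow_succ]
    ring
  · rfl

lemma insertSign_insert_mul {v w : Fin n} {G : Finset (Fin n)} (hv : v ∉ G) (hw : w ∉ G)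
    (hvw : v ≠ w) : insertSign v (insert w G) * insertSign w (insert v G) =
      -(insertSign v G * insertSign w G) := by
  rw [insertSign_insert hw, insertSign_insert hv]
  rcases lt_or_gt_of_ne hvw with h | h
  · rw [if_neg h.asymm, if_pos h]; ring
  · rw [if_pos h, if_neg h.asymm]; ring

lemma insertSign_mul_insertSign_insert {v w : Fin n} {G : Finset (Fin n)} (hv : v ∉ G)
    (hw : w ∉ G) (hvw : v ≠ w) : insertSign v G * insertSign w (insert v G) =
      -(insertSign w G * insertSign v (insert w G)) := by
  rw [insertSign_insert hw, insertSign_insert hv]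
  rcases lt_or_gt_of_ne hvw with h | h
  · rw [if_neg h.asymm, if_pos h]; ring
  · rw [if_pos h, if_neg h.asymm]; ring

/-- The boundary map of the full simplex on `Fin n`, on families indexed by all subsets. -/
def boundary (R A : Type) [CommRing R] [AddCommGroup A] [Module R A] :
    (Finset (Fin n) → A) →ₗ[R] (Finset (Fin n) → A) where
  toFun z G := ∑ v : Fin n, if v ∈ G then 0 else insertSign v G • z (insert v G)
  map_add' z w := by
    funext G
    rw [Pi.add_apply, ← Finset.sum_add_distrib]
    refine Finset.sum_congr rfl fun v _ => ?_
    split_ifs <;> simp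
  map_smul' r z := by
    funext G
    rw [RingHom.id_apply, Pi.smul_apply, Finset.smul_sum]
    refine Finset.sum_congr rfl fun v _ => ?_
    split_ifs
    · rw [smul_zero]
    · exact smul_comm _ _ _

lemma boundary_apply {R A : Type} [CommRing R] [AddCommGroup A] [Module R A]
    (z : Finset (Fin n) → A) (G : Finset (Fin n)) :
    boundary R A z G = ∑ v : Fin n, if v ∈ G then 0 else insertSign v G • z (insert v G) := rfl

lemma boundary_boundary {R A : Type} [CommRing R] [AddCommGroup A] [Module R A]
    (z : Finset (Fin n) → A) : boundary R A (boundary R A z) = 0 := by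
  funext G
  have h : boundary R A (boundary R A z) G = ∑ p : Fin n × Fin n,
      if p.1 ∈ G ∨ p.2 ∈ G ∨ p.1 = p.2 then 0 else
        (insertSign p.1 G * insertSign p.2 (insert p.1 G)) • z (insert p.2 (insert p.1 G)) := by
    rw [boundary_apply, Fintype.sum_prod_type]
    refine Finset.sum_congr rfl fun v _ => ?_
    by_cases hv : v ∈ G
    · simp [hv]
    · rw [if_neg hv, boundary_apply, Finset.smul_sum]
      refine Finset.sum_congr rfl fun w _ => ?_
      simp only [hv, false_or, Finset.mem_insert, smul_ite, smul_zero, mul_smul]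
      exact if_congr (by tauto) rfl rfl
  rw [h, Pi.zero_apply]
  refine Finset.sum_involution (fun p _ => p.swap) ?_ ?_ (fun _ _ => Finset.mem_univ _)
    (fun p _ => p.swap_swap)
  · rintro ⟨v, w⟩ -
    by_cases hc : v ∈ G ∨ w ∈ G ∨ v = w
    · simp only [Prod.swap, if_pos hc, zero_add]
      exact if_pos (by tauto)
    · have hc' : ¬(w ∈ G ∨ v ∈ G ∨ w = v) := by tauto
      push Not at hc
      dsimp only at hc ⊢
      rw [Prod.swap, if_neg (by tauto), if_neg hc',
        insertSign_mul_insertSign_insert hc.1 hc.2.1 hc.2.2, Finset.insert_comm, neg_smul,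
        neg_add_cancel]
  · rintro ⟨v, w⟩ - hne heq
    refine hne (if_pos ?_)
    simp only [Prod.swap, Prod.mk.injEq] at heq
    exact Or.inr (Or.inr heq.2)

lemma boundary_comp_apply {R S A B F : Type} [CommRing R] [CommRing S] [AddCommGroup A] [Module R A]
    [AddCommGroup B] [Module S B] [FunLike F A B] [AddMonoidHomClass F A B] (f : F)
    (z : Finset (Fin n) → A) (G : Finset (Fin n)) :
    boundary S B (fun F => f (z F)) G = f (boundary R A z G) := by
  simp only [boundary_apply, map_sum]
  refine Finset.sum_congr rfl fun v _ => ?_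
  split_ifs <;> simp

end Boundary

section LaurentComplex

open AddMonoidAlgebra (single)

variable {K : Type} [Field K] {n : ℕ}

/-- Laurent polynomials in `n` variables. -/
abbrev Laurent (K : Type) [Field K] (n : ℕ) : Type := AddMonoidAlgebra K (Fin n → ℤ)

/-- The inclusion of polynomials into Laurent polynomials. -/
noncomputable def toLaurent (K : Type) [Field K] (n : ℕ) :
    MvPolynomial (Fin n) K →ₐ[K] Laurent K n :=
  aeval fun i => single (Pi.single i 1) 1

noncomputable instance : Algebra (MvPolynomial (Fin n) K) (Laurent K n) :=
  (toLaurent K n).toRingHom.toAlgebra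

lemma laurent_smul_def (f : MvPolynomial (Fin n) K) (z : Laurent K n) :
    f • z = toLaurent K n f * z := rfl

lemma coeff_X_smul (i : Fin n) (z : Laurent K n) (a : Fin n → ℤ) :
    (X (R := K) i • z).coeff a = z.coeff (a - Pi.single i 1) := by
  rw [laurent_smul_def, toLaurent, aeval_X, AddMonoidAlgebra.coeff_single_mul_apply, one_mul,
    neg_add_eq_sub]

lemma coeff_C_smul (c : K) (z : Laurent K n) (a : Fin n → ℤ) :
    (C (σ := Fin n) c • z).coeff a = c * z.coeff a := by
  rw [laurent_smul_def, toLaurent, aeval_C, ← Algebra.smul_def, AddMonoidAlgebra.coeff_smul,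
    Finsupp.smul_apply,
    smul_eq_mul]

lemma toLaurent_monomial (m : Fin n →₀ ℕ) (c : K) :
    toLaurent K n (monomial m c) = single (fun i => (m i : ℤ)) c := by
  induction m using Finsupp.induction_linear generalizing c with
  | zero =>
    rw [monomial_zero', toLaurent, aeval_C]
    rfl
  | add f g hf hg =>
    rw [← mul_one c, ← monomial_mul, map_mul, hf, hg, AddMonoidAlgebra.single_mul_single]
    congr 1
  | single i k =>
    rw [← C_mul_X_pow_eq_monomial, map_mul, map_pow, toLaurent, aeval_C, aeval_X,
      AddMonoidAlgebra.single_pow,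
      ← Algebra.smul_def, AddMonoidAlgebra.smul_single, one_pow, smul_eq_mul, mul_one]
    congr 1
    funext j
    by_cases h : j = i
    · subst h; simp
    · simp [h]

lemma coeff_toLaurent (f : MvPolynomial (Fin n) K) (m : Fin n →₀ ℕ) :
    (toLaurent K n f).coeff (fun i => (m i : ℤ)) = f.coeff m := by
  classical
  induction f using MvPolynomial.induction_on' with
  | monomial u c =>
    rw [toLaurent_monomial, AddMonoidAlgebra.coeff_single, MvPolynomial.coeff_monomial,
      Finsupp.single_apply]
    refine if_congr ⟨fun h => ?_, fun h => h ▸ rfl⟩ rfl rfl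
    ext i
    exact_mod_cast congrFun h i
  | add p q hp hq =>
    rw [map_add, AddMonoidAlgebra.coeff_add, Finsupp.add_apply, hp, hq, MvPolynomial.coeff_add]

lemma coeff_toLaurent_of_neg (f : MvPolynomial (Fin n) K) {a : Fin n → ℤ} {i : Fin n}
    (ha : a i < 0) : (toLaurent K n f).coeff a = 0 := by
  induction f using MvPolynomial.induction_on' with
  | monomial u c =>
    rw [toLaurent_monomial, AddMonoidAlgebra.coeff_single, Finsupp.single_apply, if_neg]
    rintro rfl
    exact absurd ha (by simp)
  | add p q hp hq => rw [map_add, AddMonoidAlgebra.coeff_add, Finsupp.add_apply, hp, hq, add_zero]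

lemma exists_toLaurent_eq (z : Laurent K n)
    (hz : ∀ a, z.coeff a ≠ 0 → ∀ i, 0 ≤ a i) : ∃ f, toLaurent K n f = z := by
  refine ⟨∑ a ∈ z.coeff.support,
    monomial (Finsupp.equivFunOnFinite.symm fun i => (a i).toNat) (z.coeff a), ?_⟩
  rw [map_sum]
  conv_rhs => rw [← AddMonoidAlgebra.sum_coeff_single z, Finsupp.sum]
  refine Finset.sum_congr rfl fun a ha => ?_
  rw [toLaurent_monomial]
  congr 1
  funext i
  exact Int.toNat_of_nonneg (hz a (Finsupp.mem_support_iff.1 ha) i)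

lemma toLaurent_prod_X (F : Finset (Fin n)) :
    toLaurent K n (∏ i ∈ F, X i) = single (fun i => if i ∈ F then 1 else 0) 1 := by
  have h : (∏ i ∈ F, X i : MvPolynomial (Fin n) K) =
      monomial (Finsupp.equivFunOnFinite.symm fun i => if i ∈ F then 1 else 0) 1 := by
    rw [monomial_eq, C_1, one_mul, Finsupp.prod_fintype _ _ (fun i => pow_zero _)]
    simp
  rw [h, toLaurent_monomial]
  congr 1
  funext i
  simp

/-- A set of families of Laurent polynomials cut out by vanishing of coefficients, as a submodule:
the family `z` belongs to it iff for each `F` with `k` elements, all the coefficients of `z F` at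
exponents that are nonpositive outside `F` vanish. -/
noncomputable def vanishing (K : Type) [Field K] (n k : ℕ) :
    Submodule (MvPolynomial (Fin n) K) (Finset (Fin n) → Laurent K n) where
  carrier := {z | ∀ F : Finset (Fin n), F.card = k → ∀ a : Fin n → ℤ, (∀ i, i ∉ F → a i ≤ 0) →
    (z F).coeff a = 0}
  zero_mem' := fun F _ a _ => rfl
  add_mem' := fun {z w} hz hw F hF a ha => by
    rw [Pi.add_apply, AddMonoidAlgebra.coeff_add, Finsupp.add_apply, hz F hF a ha, hw F hF a ha,
      add_zero]
  smul_mem' := fun r z hz F hF => by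
    rw [Pi.smul_apply]
    induction r using MvPolynomial.induction_on with
    | C c => 
      intro a ha
      rw [coeff_C_smul, hz F hF a ha, mul_zero]
    | add p q hp hq => 
      intro a ha
      rw [add_smul, AddMonoidAlgebra.coeff_add, Finsupp.add_apply, hp a ha, hq a ha, add_zero]
    | mul_X p i hp => 
      intro a ha
      rw [mul_comm, mul_smul, coeff_X_smul]
      refine hp _ fun j hj => ?_
      have := ha j hj
      by_cases h : j = i
      · subst h; simp; lia
      · simpa [h] using this

lemma mem_vanishing {k : ℕ} {z : Finset (Fin n) → Laurent K n} :
    z ∈ vanishing K n k ↔ ∀ F : Finset (Fin n), F.card = k → ∀ a : Fin n → ℤ,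
      (∀ i, i ∉ F → a i ≤ 0) → (z F).coeff a = 0 := Iff.rfl

lemma coeff_boundary (z : Finset (Fin n) → Laurent K n) (G : Finset (Fin n)) (a : Fin n → ℤ) :
    (boundary (MvPolynomial (Fin n) K) (Laurent K n) z G).coeff a =
      boundary K K (fun F => (z F).coeff a) G :=
  (boundary_comp_apply (S := K) (B := K) (R := MvPolynomial (Fin n) K) (A := Laurent K n)
    ((Finsupp.applyAddHom a).comp (AddMonoidAlgebra.coeffAddEquiv (R := K)).toAddMonoidHom) z G).symm

lemma boundary_mem_vanishing {k : ℕ} {z : Finset (Fin n) → Laurent K n}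
    (hz : z ∈ vanishing K n (k + 1)) :
    boundary (MvPolynomial (Fin n) K) (Laurent K n) z ∈ vanishing K n k := by
  intro G hG a ha
  rw [coeff_boundary, boundary_apply]
  refine Finset.sum_eq_zero fun v _ => ?_
  split_ifs with hv
  · rfl
  · rw [hz _ (by rw [Finset.card_insert_of_notMem hv, hG]) a, smul_zero]
    intro i hi
    exact ha i fun h => hi (Finset.mem_insert_of_mem h)


lemma exists_boundary_sub_mem_vanishing {k : ℕ} (hk : k + 1 < n)
    {z : Finset (Fin n) → Laurent K n}
    (hz : boundary (MvPolynomial (Fin n) K) (Laurent K n) z ∈ vanishing K n k) :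
    ∃ y, boundary (MvPolynomial (Fin n) K) (Laurent K n) y - z ∈ vanishing K n (k + 1) := by
  classical
  have hv : ∀ a : Fin n → ℤ, ∃ v : Fin n, (∃ i, a i ≤ 0) → a v ≤ 0 := by
    intro a
    by_cases h : ∃ i, a i ≤ 0
    · exact ⟨h.choose, fun _ => h.choose_spec⟩
    · exact ⟨⟨0, by lia⟩, fun h' => absurd h' h⟩
  choose p hp using hv
  let y : Finset (Fin n) → Laurent K n := fun F => ∑ v ∈ F, insertSign v (F.erase v) •
    (AddMonoidAlgebra.ofCoeff ((z (F.erase v)).coeff.filter fun a => p a = v) : Laurent K n)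
  have hy : ∀ F a, (y F).coeff a = if p a ∈ F then
      insertSign (p a) (F.erase (p a)) • (z (F.erase (p a))).coeff a else 0 := by
    intro F a
    simp only [y, AddMonoidAlgebra.coeff_sum, AddMonoidAlgebra.coeff_smul, Finsupp.finsetSum_apply,
      Finsupp.smul_apply, Finsupp.filter_apply, smul_ite, smul_zero]
    rw [Finset.sum_ite_eq]
  refine ⟨y, fun G hG a ha => ?_⟩
  rw [Pi.sub_apply, AddMonoidAlgebra.coeff_sub, Finsupp.sub_apply, coeff_boundary, boundary_apply,
    sub_eq_zero]
  have hpa : a (p a) ≤ 0 := by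
    refine hp a ?_
    obtain ⟨i, hi⟩ : ∃ i, i ∉ G := by
      by_contra! h
      rw [Finset.eq_univ_iff_forall.2 h, Finset.card_univ, Fintype.card_fin] at hG
      lia
    exact ⟨i, ha i hi⟩
  by_cases hpG : p a ∈ G
  · have hG' : insert (p a) (G.erase (p a)) = G := Finset.insert_erase hpG
    have hn : p a ∉ G.erase (p a) := Finset.notMem_erase _ _
    have hc := hz (G.erase (p a)) (by rw [Finset.card_erase_of_mem hpG, hG]; rfl) a fun i hi => by
      by_cases h : i = p a
      · rw [h]; exact hpa
      · exact ha i fun h' => hi (Finset.mem_erase.2 ⟨h, h'⟩)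
    rw [coeff_boundary, boundary_apply, ← Finset.add_sum_erase _ _ (Finset.mem_univ (p a)),
      if_neg hn, hG'] at hc
    have hs : ∀ v, (if v ∈ G then 0 else insertSign v G • (y (insert v G)).coeff a) =
        if v ∈ G then 0 else -((insertSign v (G.erase (p a)) * insertSign (p a) (G.erase (p a))) •
          (z (insert v (G.erase (p a)))).coeff a) := by
      intro v
      split_ifs with hvG
      · rfl
      · have hv : v ≠ p a := fun h => hvG (h ▸ hpG)
        have he : (insert v G).erase (p a) = insert v (G.erase (p a)) := by
          rw [Finset.erase_insert_of_ne hv]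
        rw [hy, if_pos (Finset.mem_insert_of_mem hpG), he, smul_smul]
        have hm := insertSign_insert_mul (v := v) (w := p a) (G := G.erase (p a))
          (fun h => hvG (Finset.mem_of_mem_erase h)) hn hv
        rw [hG'] at hm
        rw [hm, neg_smul]
    rw [Finset.sum_congr rfl fun v _ => hs v]
    have hs2 : ∑ v, (if v ∈ G then 0 else
        -((insertSign v (G.erase (p a)) * insertSign (p a) (G.erase (p a))) •
          (z (insert v (G.erase (p a)))).coeff a)) = -(insertSign (p a) (G.erase (p a)) •
        ∑ v ∈ Finset.univ.erase (p a), if v ∈ G.erase (p a) then 0 else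
          insertSign v (G.erase (p a)) • (z (insert v (G.erase (p a)))).coeff a) := by
      rw [← Finset.add_sum_erase _ _ (Finset.mem_univ (p a)), if_pos hpG, zero_add,
        Finset.smul_sum, ← Finset.sum_neg_distrib]
      refine Finset.sum_congr rfl fun v hv => ?_
      simp only [Finset.mem_erase, ne_eq, Finset.ne_of_mem_erase hv, not_false_eq_true, true_and]
      split_ifs
      · simp
      · rw [smul_smul, mul_comm]
    rw [hs2, eq_neg_of_add_eq_zero_right hc, smul_neg, neg_neg, smul_smul, insertSign_mul_self,
      one_smul]
  · rw [Finset.sum_eq_single (p a)]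
    · rw [if_neg hpG, hy, if_pos (Finset.mem_insert_self _ _), Finset.erase_insert hpG, smul_smul,
        insertSign_mul_self, one_smul]
    · intro v _ hv
      split_ifs
      · rfl
      · rw [hy, if_neg, smul_zero]
        simp [hpG, hv.symm]
    · simp

variable (K n) in
/-- The term in degree `k` of the Cousin complex of the polynomial ring, graded by the number of
inverted variables. -/
abbrev cousin (k : ℕ) : Type :=
  (Finset (Fin n) → Laurent K n) ⧸ vanishing K n k

variable (K n) in
/-- The differential of the Cousin complex. -/
noncomputable def cousinD (k : ℕ) : cousin K n (k + 1) →ₗ[MvPolynomial (Fin n) K] cousin K n k :=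
  (vanishing K n (k + 1)).mapQ (vanishing K n k) (boundary _ _) fun _ hz =>
    boundary_mem_vanishing hz

lemma cousinD_mk (k : ℕ) (z : Finset (Fin n) → Laurent K n) :
    cousinD K n k ((vanishing K n (k + 1)).mkQ z) =
      (vanishing K n k).mkQ (boundary (MvPolynomial (Fin n) K) (Laurent K n) z) := rfl

lemma mkQ_mem_ker_cousinD {k : ℕ} {z : Finset (Fin n) → Laurent K n} :
    (vanishing K n (k + 1)).mkQ z ∈ LinearMap.ker (cousinD K n k) ↔
      boundary (MvPolynomial (Fin n) K) (Laurent K n) z ∈ vanishing K n k := by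
  rw [LinearMap.mem_ker, cousinD_mk, Submodule.mkQ_apply, Submodule.Quotient.mk_eq_zero]

lemma cousinD_cousinD (k : ℕ) (x : cousin K n (k + 2)) :
    cousinD K n k (cousinD K n (k + 1) x) = 0 := by
  obtain ⟨z, rfl⟩ := Submodule.mkQ_surjective _ x
  rw [cousinD_mk, cousinD_mk, boundary_boundary, map_zero]

lemma range_cousinD {k : ℕ} (hk : k + 1 < n) :
    LinearMap.range (cousinD K n (k + 1)) = LinearMap.ker (cousinD K n k) := by
  refine le_antisymm ?_ fun x hx => ?_
  · rintro _ ⟨x, rfl⟩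
    exact cousinD_cousinD k x
  · obtain ⟨z, rfl⟩ := Submodule.mkQ_surjective _ x
    obtain ⟨y, hy⟩ := exists_boundary_sub_mem_vanishing hk (mkQ_mem_ker_cousinD.1 hx)
    refine ⟨(vanishing K n (k + 2)).mkQ y, ?_⟩
    rw [cousinD_mk]
    exact (Submodule.Quotient.eq _).2 hy

open Abelian in
/-- `Ext` into the cycles of the Cousin complex, computed by dimension shifting. -/
theorem nonempty_ext_ker_cousinD_linearEquiv (M : ModuleCat.{0} (MvPolynomial (Fin n) K)) (k : ℕ)
    (hM : ∀ j i, k + 2 ≤ j →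
      Subsingleton (Ext.{0} M (ModuleCat.of (MvPolynomial (Fin n) K) (cousin K n j)) i)) (i : ℕ)
    (hi : k + i < n) :
    Nonempty (Ext.{0} M (ModuleCat.of (MvPolynomial (Fin n) K)
        (LinearMap.ker (cousinD K n (k + i)))) i ≃ₗ[MvPolynomial (Fin n) K]
      Ext.{0} M (ModuleCat.of (MvPolynomial (Fin n) K) (LinearMap.ker (cousinD K n k))) 0) := by
  induction i with
  | zero => exact ⟨LinearEquiv.refl _ _⟩
  | succ i ih =>
    obtain ⟨e⟩ := ih (by lia)
    obtain ⟨e'⟩ := nonempty_ext_linearEquiv_of_exact M i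
      (LinearMap.ker (cousinD K n (k + i + 1))).subtype
      ((cousinD K n (k + i + 1)).codRestrict (LinearMap.ker (cousinD K n (k + i)))
        fun x => LinearMap.mem_ker.2 (cousinD_cousinD _ x))
      (Submodule.subtype_injective _)
      (by
        rintro ⟨x, hx⟩
        rw [← range_cousinD (by lia)] at hx
        obtain ⟨y, rfl⟩ := hx
        exact ⟨y, rfl⟩)
      (LinearMap.exact_iff.2 (by rw [LinearMap.ker_codRestrict, Submodule.range_subtype]))
      (hM _ _ (by lia)) (hM _ _ (by lia))
    exact ⟨e'.trans e⟩

variable (K) in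
/-- Extraction of the component at `F` of a family of Laurent polynomials, divided by the product
of the variables in `F`. -/
noncomputable def divComponent (F : Finset (Fin n)) :
    (Finset (Fin n) → Laurent K n) →ₗ[MvPolynomial (Fin n) K] (Finset (Fin n) → Laurent K n) :=
  LinearMap.single _ (fun _ => Laurent K n) F ∘ₗ
    LinearMap.mulLeft _ (single (-fun i => if i ∈ F then 1 else 0) 1 : Laurent K n) ∘ₗ
      LinearMap.proj F

lemma divComponent_mem_vanishing {k : ℕ} (F : Finset (Fin n)) {z : Finset (Fin n) → Laurent K n}
    (hz : z ∈ vanishing K n k) : divComponent K F z ∈ vanishing K n k := by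
  intro G hG a ha
  by_cases h : G = F
  · subst h
    simp only [divComponent, LinearMap.comp_apply, LinearMap.proj_apply, LinearMap.single_apply,
      Pi.single_eq_same, LinearMap.mulLeft_apply, AddMonoidAlgebra.coeff_single_mul_apply, one_mul]
    refine hz G hG _ fun i hi => ?_
    simpa [hi] using ha i hi
  · simp [divComponent, h]

lemma prod_X_smul_divComponent (F : Finset (Fin n)) (z : Finset (Fin n) → Laurent K n) :
    (∏ i ∈ F, X i : MvPolynomial (Fin n) K) • divComponent K F z = Pi.single F (z F) := by
  rw [divComponent, LinearMap.comp_apply, ← map_smul, LinearMap.comp_apply,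
    LinearMap.mulLeft_apply, laurent_smul_def, ← mul_assoc, toLaurent_prod_X,
    AddMonoidAlgebra.single_mul_single, add_neg_cancel, one_mul, ← AddMonoidAlgebra.one_def,
    one_mul]
  rfl

lemma sum_prod_X_smul_divComponent (k : ℕ) :
    ∑ F : {F : Finset (Fin n) // F.card = k}, (∏ i ∈ F.1, X i : MvPolynomial (Fin n) K) •
      (vanishing K n k).mapQ (vanishing K n k) (divComponent K F.1)
        (fun _ hz => divComponent_mem_vanishing F.1 hz) = LinearMap.id := by
  refine LinearMap.ext fun x => ?_
  obtain ⟨z, rfl⟩ := Submodule.mkQ_surjective _ x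
  have h : ∑ F : {F : Finset (Fin n) // F.card = k},
      (∏ i ∈ F.1, X i : MvPolynomial (Fin n) K) • divComponent K F.1 z - z ∈ vanishing K n k := by
    intro G hG a _
    rw [Pi.sub_apply, Finset.sum_apply, Finset.sum_eq_single ⟨G, hG⟩, prod_X_smul_divComponent,
      Pi.single_eq_same, sub_self]
    · rfl
    · intro F _ hF
      rw [prod_X_smul_divComponent]
      exact Pi.single_eq_of_ne (fun h => hF (Subtype.ext h.symm)) _
    · simp
  have h' := (Submodule.Quotient.eq _).2 h
  rw [← Submodule.mkQ_apply, ← Submodule.mkQ_apply, map_sum] at h'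
  rw [LinearMap.sum_apply, LinearMap.id_apply]
  exact (Finset.sum_congr rfl fun F _ => rfl).trans h'

open Abelian in
lemma subsingleton_ext_cousin {M : Type} [AddCommGroup M] [Module (MvPolynomial (Fin n) K) M]
    (k i : ℕ) (hM : ∀ F : Finset (Fin n), F.card = k →
      (∏ i ∈ F, X i : MvPolynomial (Fin n) K) ∈ Module.annihilator _ M) :
    Subsingleton (Ext.{0} (ModuleCat.of (MvPolynomial (Fin n) K) M)
      (ModuleCat.of (MvPolynomial (Fin n) K) (cousin K n k)) i) :=
  subsingleton_ext_of_sum_smul_eq_id (M := M) (E := cousin K n k) i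
    (fun F : {F : Finset (Fin n) // F.card = k} => ∏ i ∈ F.1, X i)
    (fun F => (vanishing K n k).mapQ (vanishing K n k) (divComponent K F.1)
        (fun _ hz => divComponent_mem_vanishing F.1 hz)) (fun F => hM F.1 F.2)
    (sum_prod_X_smul_divComponent k)

variable (K n) in
/-- The map from the polynomial ring to the top degree of the Cousin complex, given by
multiplication by the product of all variables. -/
noncomputable def topMap :
    MvPolynomial (Fin n) K →ₗ[MvPolynomial (Fin n) K] (Finset (Fin n) → Laurent K n) :=
  LinearMap.single _ (fun _ => Laurent K n) Finset.univ ∘ₗ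
    LinearMap.mulLeft _ (single 1 1 : Laurent K n) ∘ₗ Algebra.linearMap _ _

lemma coeff_topMap_univ (f : MvPolynomial (Fin n) K) (a : Fin n → ℤ) :
    (topMap K n f Finset.univ).coeff a = (toLaurent K n f).coeff (a - 1) := by
  simp only [topMap, LinearMap.comp_apply, LinearMap.single_apply, Pi.single_eq_same,
    LinearMap.mulLeft_apply, AddMonoidAlgebra.coeff_single_mul_apply, one_mul, neg_add_eq_sub]
  rfl

lemma eq_univ_of_card {G : Finset (Fin n)} (hn : n ≠ 0) (hG : G.card = n - 1 + 1) :
    G = Finset.univ := by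
  rw [← Finset.card_eq_iff_eq_univ, hG, Fintype.card_fin]
  lia

lemma mkQ_topMap_mem_ker (hn : n ≠ 0) (f : MvPolynomial (Fin n) K) :
    (vanishing K n (n - 1 + 1)).mkQ (topMap K n f) ∈ LinearMap.ker (cousinD K n (n - 1)) := by
  rw [mkQ_mem_ker_cousinD]
  intro G hG a ha
  rw [coeff_boundary, boundary_apply]
  refine Finset.sum_eq_zero fun v _ => ?_
  split_ifs with hv
  · rfl
  · rw [eq_univ_of_card (G := insert v G) hn (by rw [Finset.card_insert_of_notMem hv, hG]),
      coeff_topMap_univ, coeff_toLaurent_of_neg f (i := v) _, smul_zero]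
    have := ha v hv
    simp only [Pi.sub_apply, Pi.one_apply]
    lia

lemma topMap_eq_zero_of_mem_vanishing {f : MvPolynomial (Fin n) K}
    (hf : topMap K n f ∈ vanishing K n n) : f = 0 := by
  ext m
  have := hf Finset.univ (by rw [Finset.card_univ, Fintype.card_fin])
    ((fun i => (m i : ℤ)) + 1) (fun i hi => absurd (Finset.mem_univ i) hi)
  rwa [coeff_topMap_univ, add_sub_cancel_right, coeff_toLaurent] at this

lemma exists_topMap_sub_mem_vanishing (hn : n ≠ 0) {z : Finset (Fin n) → Laurent K n}
    (hz : boundary (MvPolynomial (Fin n) K) (Laurent K n) z ∈ vanishing K n (n - 1)) :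
    ∃ f, topMap K n f - z ∈ vanishing K n (n - 1 + 1) := by
  obtain ⟨f, hf⟩ := exists_toLaurent_eq (single (-1) 1 * z Finset.univ) fun a ha i => by
    rw [AddMonoidAlgebra.coeff_single_mul_apply, one_mul, neg_neg] at ha
    by_contra! hai
    have hi : i ∉ Finset.univ.erase i := Finset.notMem_erase _ _
    have := hz (Finset.univ.erase i)
      (by rw [Finset.card_erase_of_mem (Finset.mem_univ i), Finset.card_univ, Fintype.card_fin])
      (1 + a) (fun j hj => by
        have : j = i := by simpa using hj
        subst this
        simp only [Pi.add_apply, Pi.one_apply]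
        lia)
    rw [coeff_boundary, boundary_apply, Finset.sum_eq_single i, if_neg hi,
      Finset.insert_erase (Finset.mem_univ i)] at this
    · refine ha ?_
      have h2 := congrArg (insertSign i (Finset.univ.erase i) • ·) this
      simpa only [smul_smul, insertSign_mul_self, one_smul, smul_zero] using h2
    · intro j _ hj
      exact if_pos (by simpa using hj)
    · simp
  refine ⟨f, fun G hG a _ => ?_⟩
  rw [eq_univ_of_card hn hG, Pi.sub_apply, AddMonoidAlgebra.coeff_sub, Finsupp.sub_apply,
    coeff_topMap_univ, hf, AddMonoidAlgebra.coeff_single_mul_apply, one_mul, neg_neg,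
    add_sub_cancel, sub_self]

/-- The cycles in top degree of the Cousin complex form a free module of rank one. -/
theorem nonempty_linearEquiv_ker_cousinD (hn : n ≠ 0) :
    Nonempty (MvPolynomial (Fin n) K ≃ₗ[MvPolynomial (Fin n) K]
      LinearMap.ker (cousinD K n (n - 1))) := by
  refine ⟨LinearEquiv.ofBijective (LinearMap.codRestrict _
    ((vanishing K n (n - 1 + 1)).mkQ ∘ₗ topMap K n) (mkQ_topMap_mem_ker hn)) ⟨?_, ?_⟩⟩
  · refine (injective_iff_map_eq_zero _).2 fun f hf => topMap_eq_zero_of_mem_vanishing ?_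
    have := (Submodule.Quotient.mk_eq_zero _).1 (congrArg Subtype.val hf)
    rwa [Nat.sub_add_cancel (Nat.one_le_iff_ne_zero.2 hn)] at this
  · rintro ⟨x, hx⟩
    obtain ⟨z, rfl⟩ := Submodule.mkQ_surjective _ x
    obtain ⟨f, hf⟩ := exists_topMap_sub_mem_vanishing hn (mkQ_mem_ker_cousinD.1 hx)
    exact ⟨f, Subtype.ext ((Submodule.Quotient.eq _).2 hf)⟩

end LaurentComplex

section FaceComplex

variable {K : Type} [Field K] {n : ℕ}

variable (K) in
/-- The retraction of the polynomial ring onto the polynomials in the variables of a face `F`,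
killing all other variables. -/
noncomputable def restrict (F : Finset (Fin n)) :
    MvPolynomial (Fin n) K →ₐ[K] MvPolynomial (Fin n) K :=
  aeval fun i => if i ∈ F then X i else 0

lemma restrict_X_of_mem {F : Finset (Fin n)} {i : Fin n} (hi : i ∈ F) :
    restrict K F (X i) = X i := by
  rw [restrict, aeval_X, if_pos hi]

lemma restrict_X_of_notMem {F : Finset (Fin n)} {i : Fin n} (hi : i ∉ F) :
    restrict K F (X i) = 0 := by
  rw [restrict, aeval_X, if_neg hi]

lemma restrict_restrict (F G : Finset (Fin n)) (f : MvPolynomial (Fin n) K) :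
    restrict K F (restrict K G f) = restrict K (F ∩ G) f := by
  rw [← AlgHom.comp_apply]
  congr 1
  refine MvPolynomial.algHom_ext fun i => ?_
  rw [AlgHom.comp_apply]
  by_cases hG : i ∈ G
  · rw [restrict_X_of_mem hG]
    by_cases hF : i ∈ F
    · rw [restrict_X_of_mem hF, restrict_X_of_mem (Finset.mem_inter.2 ⟨hF, hG⟩)]
    · rw [restrict_X_of_notMem hF, restrict_X_of_notMem fun h => hF (Finset.mem_inter.1 h).1]
  · rw [restrict_X_of_notMem hG, map_zero,
      restrict_X_of_notMem fun h => hG (Finset.mem_inter.1 h).2]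

lemma restrict_restrict_of_subset {F G : Finset (Fin n)} (h : F ⊆ G)
    (f : MvPolynomial (Fin n) K) : restrict K F (restrict K G f) = restrict K F f := by
  rw [restrict_restrict, Finset.inter_eq_left.2 h]

lemma restrict_self (F : Finset (Fin n)) (f : MvPolynomial (Fin n) K) :
    restrict K F (restrict K F f) = restrict K F f :=
  restrict_restrict_of_subset subset_rfl f

lemma restrict_prod_X_of_not_subset {F S : Finset (Fin n)} (h : ¬S ⊆ F) :
    restrict K F (∏ i ∈ S, X i) = 0 := by
  obtain ⟨i, hi, hiF⟩ := Finset.not_subset.1 h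
  rw [map_prod]
  exact Finset.prod_eq_zero hi (restrict_X_of_notMem hiF)

lemma restrict_prod_X_of_subset {F S : Finset (Fin n)} (h : S ⊆ F) :
    restrict K F (∏ i ∈ S, X i) = ∏ i ∈ S, X i := by
  rw [map_prod]
  exact Finset.prod_congr rfl fun i hi => restrict_X_of_mem (h hi)

lemma coeff_restrict (F : Finset (Fin n)) (f : MvPolynomial (Fin n) K) (m : Fin n →₀ ℕ) :
    coeff m (restrict K F f) = if ∀ i, i ∉ F → m i = 0 then coeff m f else 0 := by
  classical
  induction f using MvPolynomial.induction_on' with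
  | monomial u c =>
    by_cases hu : ∀ i, i ∉ F → u i = 0
    · have : restrict K F (monomial u c) = monomial u c := by
        rw [restrict, aeval_monomial, monomial_eq]
        congr 1
        refine Finsupp.prod_congr fun i hi => ?_
        rw [if_pos]
        by_contra h
        exact Finsupp.mem_support_iff.1 hi (hu i h)
      rw [this, coeff_monomial]
      split_ifs with h1 h2 h2
      · rfl
      · exact absurd (h1 ▸ hu) h2
      · rfl
      · rfl
    · have : restrict K F (monomial u c) = 0 := by
        push Not at hu
        obtain ⟨i, hi, hui⟩ := hu
        rw [restrict, aeval_monomial, Finsupp.prod,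
          Finset.prod_eq_zero (Finsupp.mem_support_iff.2 hui), mul_zero]
        rw [if_neg hi, zero_pow hui]
      rw [this, coeff_zero, coeff_monomial]
      split_ifs with h1 h2
      · exact absurd (h2 ▸ h1) hu
      · rfl
      · rfl
  | add p q hp hq =>
    rw [map_add, MvPolynomial.coeff_add, hp, hq, MvPolynomial.coeff_add]
    split_ifs <;> simp

lemma restrict_eq_zero_iff (F : Finset (Fin n)) (f : MvPolynomial (Fin n) K) :
    restrict K F f = 0 ↔ ∀ m : Fin n →₀ ℕ, (∀ i, i ∉ F → m i = 0) → coeff m f = 0 := by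
  rw [MvPolynomial.ext_iff]
  refine forall_congr' fun m => ?_
  rw [coeff_restrict, coeff_zero]
  exact ite_eq_right_iff

variable (K) in
/-- Truncation of a family indexed by all subsets to the faces of `Δ`. -/
noncomputable def truncate (Δ : Finset (Finset (Fin n))) :
    (Finset (Fin n) → MvPolynomial (Fin n) K) →ₗ[MvPolynomial (Fin n) K]
      (Finset (Fin n) → MvPolynomial (Fin n) K) :=
  LinearMap.pi fun F => if F ∈ Δ then LinearMap.proj F else 0

lemma truncate_apply (Δ : Finset (Finset (Fin n))) (f : Finset (Fin n) → MvPolynomial (Fin n) K)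
    (F : Finset (Fin n)) : truncate K Δ f F = if F ∈ Δ then f F else 0 := by
  rw [truncate, LinearMap.pi_apply]
  split_ifs <;> rfl

variable (K) in
/-- The simplicial boundary on families of polynomials indexed by the faces of `Δ`. -/
noncomputable def faceBoundary (Δ : Finset (Finset (Fin n))) :
    (Finset (Fin n) → MvPolynomial (Fin n) K) →ₗ[MvPolynomial (Fin n) K]
      (Finset (Fin n) → MvPolynomial (Fin n) K) :=
  boundary _ _ ∘ₗ truncate K Δ

lemma faceBoundary_apply (Δ : Finset (Finset (Fin n)))
    (f : Finset (Fin n) → MvPolynomial (Fin n) K) (G : Finset (Fin n)) :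
    faceBoundary K Δ f G = ∑ v : Fin n, if v ∉ G ∧ insert v G ∈ Δ then
      insertSign v G • f (insert v G) else 0 := by
  rw [faceBoundary, LinearMap.comp_apply, boundary_apply]
  refine Finset.sum_congr rfl fun v _ => ?_
  rw [truncate_apply]
  by_cases h1 : v ∈ G <;> by_cases h2 : insert v G ∈ Δ <;> simp [h1, h2]

lemma faceBoundary_eq_zero_of_notMem {Δ : Finset (Finset (Fin n))} (hΔ : IsSimplicialComplex Δ)
    (f : Finset (Fin n) → MvPolynomial (Fin n) K) {G : Finset (Fin n)} (hG : G ∉ Δ) :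
    faceBoundary K Δ f G = 0 := by
  rw [faceBoundary_apply]
  exact Finset.sum_eq_zero fun v _ => if_neg fun h => hG (hΔ _ h.2 _ (Finset.subset_insert _ _))

lemma faceBoundary_faceBoundary {Δ : Finset (Finset (Fin n))} (hΔ : IsSimplicialComplex Δ)
    (f : Finset (Fin n) → MvPolynomial (Fin n) K) : faceBoundary K Δ (faceBoundary K Δ f) = 0 := by
  have h : truncate K Δ (faceBoundary K Δ f) = faceBoundary K Δ f := by
    funext F
    rw [truncate_apply]
    split_ifs with hF
    · rfl
    · exact (faceBoundary_eq_zero_of_notMem hΔ f hF).symm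
  have h' : faceBoundary K Δ (faceBoundary K Δ f) =
      boundary (MvPolynomial (Fin n) K) (MvPolynomial (Fin n) K)
        (truncate K Δ (faceBoundary K Δ f)) := rfl
  rw [h', h, faceBoundary, LinearMap.comp_apply, boundary_boundary]

variable (K) in
/-- The families of polynomials which restrict to zero on the faces with `k` elements. -/
noncomputable def faceKer (Δ : Finset (Finset (Fin n))) (k : ℕ) :
    Submodule (MvPolynomial (Fin n) K) (Finset (Fin n) → MvPolynomial (Fin n) K) where
  carrier := {f | ∀ F ∈ Δ, F.card = k → restrict K F (f F) = 0}
  zero_mem' := fun F _ _ => map_zero _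
  add_mem' := fun {f g} hf hg F hF hk => by
    rw [Pi.add_apply, map_add, hf F hF hk, hg F hF hk, add_zero]
  smul_mem' := fun r f hf F hF hk => by
    rw [Pi.smul_apply, smul_eq_mul, map_mul, hf F hF hk, mul_zero]

lemma mem_faceKer {Δ : Finset (Finset (Fin n))} {k : ℕ}
    {f : Finset (Fin n) → MvPolynomial (Fin n) K} :
    f ∈ faceKer K Δ k ↔ ∀ F ∈ Δ, F.card = k → restrict K F (f F) = 0 := Iff.rfl

lemma faceBoundary_mem_faceKer {Δ : Finset (Finset (Fin n))} {k : ℕ}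
    {f : Finset (Fin n) → MvPolynomial (Fin n) K} (hf : f ∈ faceKer K Δ (k + 1)) :
    faceBoundary K Δ f ∈ faceKer K Δ k := by
  intro G _ hk
  rw [faceBoundary_apply, map_sum]
  refine Finset.sum_eq_zero fun v _ => ?_
  split_ifs with h
  · rw [map_zsmul, ← restrict_restrict_of_subset (Finset.subset_insert v G),
      hf _ h.2 (by rw [Finset.card_insert_of_notMem h.1, hk]), map_zero, smul_zero]
  · exact map_zero _

variable (K) in
/-- The direct sum over the `k`-element faces `F` of `Δ` of the polynomial rings on `F`. -/
abbrev faceModule (Δ : Finset (Finset (Fin n))) (k : ℕ) : Type :=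
  (Finset (Fin n) → MvPolynomial (Fin n) K) ⧸ faceKer K Δ k

variable (K) in
/-- The simplicial boundary map between direct sums of polynomial rings on faces. -/
noncomputable def faceD (Δ : Finset (Finset (Fin n))) (k : ℕ) :
    faceModule K Δ (k + 1) →ₗ[MvPolynomial (Fin n) K] faceModule K Δ k :=
  (faceKer K Δ (k + 1)).mapQ (faceKer K Δ k) (faceBoundary K Δ) fun _ hf =>
    faceBoundary_mem_faceKer hf

lemma faceD_mk (Δ : Finset (Finset (Fin n))) (k : ℕ)
    (f : Finset (Fin n) → MvPolynomial (Fin n) K) :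
    faceD K Δ k ((faceKer K Δ (k + 1)).mkQ f) = (faceKer K Δ k).mkQ (faceBoundary K Δ f) := rfl

lemma mkQ_mem_ker_faceD {Δ : Finset (Finset (Fin n))} {k : ℕ}
    {f : Finset (Fin n) → MvPolynomial (Fin n) K} :
    (faceKer K Δ (k + 1)).mkQ f ∈ LinearMap.ker (faceD K Δ k) ↔
      faceBoundary K Δ f ∈ faceKer K Δ k := by
  rw [LinearMap.mem_ker, faceD_mk, Submodule.mkQ_apply, Submodule.Quotient.mk_eq_zero]

lemma faceD_faceD {Δ : Finset (Finset (Fin n))} (hΔ : IsSimplicialComplex Δ) (k : ℕ)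
    (x : faceModule K Δ (k + 2)) : faceD K Δ k (faceD K Δ (k + 1) x) = 0 := by
  obtain ⟨f, rfl⟩ := Submodule.mkQ_surjective _ x
  rw [faceD_mk, faceD_mk, faceBoundary_faceBoundary hΔ, map_zero]

end FaceComplex

section Comparison

open AddMonoidAlgebra (single)

variable {K : Type} [Field K] {n : ℕ} {Δ : Finset (Finset (Fin n))}

lemma coeff_toLaurent_eq_zero_iff (F : Finset (Fin n)) (f : MvPolynomial (Fin n) K) :
    (∀ a : Fin n → ℤ, (∀ i, i ∉ F → a i ≤ 0) → (toLaurent K n f).coeff a = 0) ↔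
      restrict K F f = 0 := by
  rw [restrict_eq_zero_iff]
  constructor
  · intro h m hm
    rw [← coeff_toLaurent]
    exact h _ fun i hi => by rw [hm i hi]; rfl
  · intro h a ha
    by_cases h0 : ∃ i, a i < 0
    · obtain ⟨i, hi⟩ := h0
      exact coeff_toLaurent_of_neg f hi
    · push Not at h0
      lift a to Fin n → ℕ using h0
      have := h (Finsupp.equivFunOnFinite.symm a) fun i hi => by simpa using ha i hi
      rwa [← coeff_toLaurent] at this

variable (K) in
/-- The map from families of polynomials on faces to families of Laurent polynomials. -/
noncomputable def faceToLaurent (Δ : Finset (Finset (Fin n))) :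
    (Finset (Fin n) → MvPolynomial (Fin n) K) →ₗ[MvPolynomial (Fin n) K]
      (Finset (Fin n) → Laurent K n) :=
  (Algebra.linearMap (MvPolynomial (Fin n) K) (Laurent K n)).compLeft _ ∘ₗ truncate K Δ

lemma faceToLaurent_apply (f : Finset (Fin n) → MvPolynomial (Fin n) K) (F : Finset (Fin n)) :
    faceToLaurent K Δ f F = toLaurent K n (truncate K Δ f F) := rfl

lemma boundary_faceToLaurent (f : Finset (Fin n) → MvPolynomial (Fin n) K)
    (G : Finset (Fin n)) :
    boundary (MvPolynomial (Fin n) K) (Laurent K n) (faceToLaurent K Δ f) G =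
      toLaurent K n (faceBoundary K Δ f G) :=
  boundary_comp_apply (R := MvPolynomial (Fin n) K) (S := MvPolynomial (Fin n) K)
    (A := MvPolynomial (Fin n) K) (B := Laurent K n) (toLaurent K n) (truncate K Δ f) G

lemma faceToLaurent_mem_vanishing {k : ℕ} {f : Finset (Fin n) → MvPolynomial (Fin n) K} :
    faceToLaurent K Δ f ∈ vanishing K n k ↔ f ∈ faceKer K Δ k := by
  rw [mem_vanishing, mem_faceKer]
  refine forall_congr' fun F => ?_
  rw [faceToLaurent_apply, coeff_toLaurent_eq_zero_iff, truncate_apply]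
  split_ifs with h
  · simp [h]
  · simp [h]

lemma boundary_faceToLaurent_mem_vanishing (hΔ : IsSimplicialComplex Δ) {k : ℕ}
    {f : Finset (Fin n) → MvPolynomial (Fin n) K} :
    boundary (MvPolynomial (Fin n) K) (Laurent K n) (faceToLaurent K Δ f) ∈ vanishing K n k ↔
      faceBoundary K Δ f ∈ faceKer K Δ k := by
  rw [mem_vanishing, mem_faceKer]
  refine forall_congr' fun F => ?_
  rw [boundary_faceToLaurent, coeff_toLaurent_eq_zero_iff]
  by_cases h : F ∈ Δ
  · simp [h]
  · simp [h, faceBoundary_eq_zero_of_notMem hΔ]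

lemma prod_X_smul_mem_faceKer (hΔ : IsSimplicialComplex Δ) {S : Finset (Fin n)} (hS : S ∉ Δ)
    (k : ℕ) (f : Finset (Fin n) → MvPolynomial (Fin n) K) :
    (∏ i ∈ S, X i : MvPolynomial (Fin n) K) • f ∈ faceKer K Δ k := by
  intro F hF _
  rw [Pi.smul_apply, smul_eq_mul, map_mul,
    restrict_prod_X_of_not_subset fun h => hS (hΔ F hF S h), zero_mul]

lemma coeff_eq_zero_of_prod_X_smul_mem_vanishing {k : ℕ} {S F : Finset (Fin n)}
    {z : Finset (Fin n) → Laurent K n}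
    (hz : (∏ i ∈ S, X i : MvPolynomial (Fin n) K) • z ∈ vanishing K n k) (hF : F.card = k)
    {a : Fin n → ℤ} (ha : ∀ i, i ∉ F → a i ≤ 0) (haS : ∀ i, i ∈ S → i ∉ F → a i < 0) :
    (z F).coeff a = 0 := by
  have := hz F hF (a + fun i => if i ∈ S then 1 else 0) fun i hi => by
    rw [Pi.add_apply]
    split_ifs with h
    · exact haS i h hi
    · rw [add_zero]; exact ha i hi
  rwa [Pi.smul_apply, laurent_smul_def, toLaurent_prod_X,
    AddMonoidAlgebra.coeff_single_mul_apply, one_mul, neg_add_cancel_comm_assoc] at this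

/-- A cycle of the Cousin complex annihilated by the monomials of non-faces comes from a family of
polynomials on faces. -/
lemma exists_faceToLaurent_sub_mem_vanishing {k : ℕ} (hdim : ∀ s ∈ Δ, s.card ≤ k + 1)
    {z : Finset (Fin n) → Laurent K n}
    (hz : boundary (MvPolynomial (Fin n) K) (Laurent K n) z ∈ vanishing K n k)
    (hS : ∀ S : Finset (Fin n), S ∉ Δ →
      (∏ i ∈ S, X i : MvPolynomial (Fin n) K) • z ∈ vanishing K n (k + 1)) :
    ∃ f, faceToLaurent K Δ f - z ∈ vanishing K n (k + 1) := by
  classical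
  have h1 : ∀ F : Finset (Fin n), F.card = k + 1 → F ∉ Δ → ∀ a : Fin n → ℤ,
      (∀ i, i ∉ F → a i ≤ 0) → (z F).coeff a = 0 := fun F hF hFΔ a ha =>
    coeff_eq_zero_of_prod_X_smul_mem_vanishing (hS F hFΔ) hF ha fun i h h' => absurd h h'
  have h2 : ∀ F : Finset (Fin n), F.card = k + 1 → ∀ a : Fin n → ℤ,
      (∀ i, i ∉ F → a i ≤ 0) → (∃ i, i ∉ F ∧ a i < 0) → (z F).coeff a = 0 := by
    rintro F hF a ha ⟨i, hi, hai⟩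
    refine coeff_eq_zero_of_prod_X_smul_mem_vanishing (hS (insert i F) fun h => ?_) hF ha
      fun j hj hjF => ?_
    · have := hdim _ h
      rw [Finset.card_insert_of_notMem hi, hF] at this
      lia
    · obtain rfl : j = i := (Finset.mem_insert.1 hj).resolve_right hjF
      exact hai
  have h3 : ∀ F : Finset (Fin n), F.card = k + 1 → ∀ a : Fin n → ℤ,
      (∀ i, i ∉ F → a i ≤ 0) → (∃ i, a i < 0) → (z F).coeff a = 0 := by
    rintro F hF a ha ⟨v, hav⟩
    by_cases hv : v ∈ F
    · have hn : v ∉ F.erase v := Finset.notMem_erase v F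
      have ha' : ∀ i, i ∉ F.erase v → a i ≤ 0 := fun i hi => by
        by_cases h : i = v
        · subst h; exact hav.le
        · exact ha i fun h' => hi (Finset.mem_erase.2 ⟨h, h'⟩)
      have hc : (F.erase v).card = k := by rw [Finset.card_erase_of_mem hv, hF]; rfl
      have := hz (F.erase v) hc a ha'
      rw [coeff_boundary, boundary_apply, Finset.sum_eq_single v, if_neg hn,
        Finset.insert_erase hv] at this
      · have h := congrArg (insertSign v (F.erase v) • ·) this
        simpa only [smul_smul, insertSign_mul_self, one_smul, smul_zero] using h
      · intro w _ hw
        split_ifs with h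
        · rfl
        · rw [h2 _ (by rw [Finset.card_insert_of_notMem h, hc]) a
            (fun i hi => ha' i fun h' => hi (Finset.mem_insert_of_mem h'))
            ⟨v, by simp [hw.symm], hav⟩, smul_zero]
      · simp
    · exact h2 F hF a ha ⟨v, hv, hav⟩
  have h4 : ∀ F : Finset (Fin n), ∃ f, toLaurent K n f = AddMonoidAlgebra.ofCoeff
      ((z F).coeff.filter fun a => ∀ i, 0 ≤ a i) := by
    intro F
    refine exists_toLaurent_eq _ fun a ha => ?_
    by_contra h
    exact ha (Finsupp.filter_apply_neg _ _ h)
  choose f hf using h4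
  refine ⟨f, fun F hF a ha => ?_⟩
  rw [Pi.sub_apply, AddMonoidAlgebra.coeff_sub, Finsupp.sub_apply, faceToLaurent_apply,
    truncate_apply]
  by_cases hFΔ : F ∈ Δ
  · rw [if_pos hFΔ, hf]
    by_cases h : ∃ i, a i < 0
    · rw [h3 F hF a ha h, AddMonoidAlgebra.coeff_ofCoeff, Finsupp.filter_apply, h3 F hF a ha h,
        ite_self, sub_zero]
    · push Not at h
      rw [AddMonoidAlgebra.coeff_ofCoeff, Finsupp.filter_apply_pos _ _ h, sub_self]
  · rw [if_neg hFΔ, h1 F hF hFΔ a ha, map_zero]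
    simp

variable (K Δ) in
/-- The map from the face modules to the Cousin complex. -/
noncomputable def faceToCousin (k : ℕ) :
    faceModule K Δ k →ₗ[MvPolynomial (Fin n) K] cousin K n k :=
  (faceKer K Δ k).mapQ (vanishing K n k) (faceToLaurent K Δ) fun _ hf =>
    faceToLaurent_mem_vanishing.2 hf

lemma faceToCousin_mk (k : ℕ) (f : Finset (Fin n) → MvPolynomial (Fin n) K) :
    faceToCousin K Δ k ((faceKer K Δ k).mkQ f) =
      (vanishing K n k).mkQ (faceToLaurent K Δ f) := rfl

lemma faceToCousin_injective (k : ℕ) : Function.Injective (faceToCousin K Δ k) := by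
  refine (injective_iff_map_eq_zero _).2 fun x hx => ?_
  obtain ⟨f, rfl⟩ := Submodule.mkQ_surjective _ x
  exact (Submodule.Quotient.mk_eq_zero _).2
    (faceToLaurent_mem_vanishing.1 ((Submodule.Quotient.mk_eq_zero _).1 hx))

lemma map_ker_faceD (hΔ : IsSimplicialComplex Δ) {k : ℕ} (hdim : ∀ s ∈ Δ, s.card ≤ k + 1)
    (x : cousin K n (k + 1)) :
    x ∈ (LinearMap.ker (faceD K Δ k)).map (faceToCousin K Δ (k + 1)) ↔
      x ∈ LinearMap.ker (cousinD K n k) ∧ ∀ r ∈ stanleyReisnerIdeal K Δ, r • x = 0 := by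
  constructor
  · rintro ⟨y, hy, rfl⟩
    obtain ⟨f, rfl⟩ := Submodule.mkQ_surjective _ y
    refine ⟨mkQ_mem_ker_cousinD.2 ((boundary_faceToLaurent_mem_vanishing hΔ).2
      (mkQ_mem_ker_faceD.1 hy)), fun r hr => ?_⟩
    rw [← map_smul]
    suffices h : r • (faceKer K Δ (k + 1)).mkQ f = 0 by rw [h, map_zero]
    refine Submodule.span_induction ?_ (zero_smul _ _) ?_ ?_ hr
    · rintro _ ⟨S, hS, rfl⟩
      exact (Submodule.Quotient.mk_eq_zero _).2 (prod_X_smul_mem_faceKer hΔ hS _ f)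
    · intro p q _ _ hp hq
      rw [add_smul, hp, hq, add_zero]
    · intro p q _ hq
      rw [smul_eq_mul, mul_smul, hq, smul_zero]
  · rintro ⟨hx, hr⟩
    obtain ⟨z, rfl⟩ := Submodule.mkQ_surjective _ x
    obtain ⟨f, hf⟩ := exists_faceToLaurent_sub_mem_vanishing hdim (mkQ_mem_ker_cousinD.1 hx)
      fun S hS => (Submodule.Quotient.mk_eq_zero _).1 (hr _ (Ideal.subset_span ⟨S, hS, rfl⟩))
    have hfz : faceToCousin K Δ (k + 1) ((faceKer K Δ (k + 1)).mkQ f) =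
      (vanishing K n (k + 1)).mkQ z := (Submodule.Quotient.eq _).2 hf
    refine ⟨_, ?_, hfz⟩
    rw [← hfz, faceToCousin_mk, mkQ_mem_ker_cousinD,
      boundary_faceToLaurent_mem_vanishing hΔ] at hx
    exact mkQ_mem_ker_faceD.2 hx

end Comparison

section CanonicalModule

open Abelian

/-- Isomorphic modules have isomorphic `Ext` modules. -/
noncomputable def extCongrRight {R : Type} [CommRing R] (M : ModuleCat.{0} R) {N N' : Type}
    [AddCommGroup N] [Module R N] [AddCommGroup N'] [Module R N'] (e : N ≃ₗ[R] N') (i : ℕ) :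
    Ext.{0} M (ModuleCat.of R N) i ≃ₗ[R] Ext.{0} M (ModuleCat.of R N') i :=
  LinearEquiv.ofLinearMap
    ((Ext.mk₀ e.toModuleIso.hom).postcompOfLinear R M (add_zero i))
    ((Ext.mk₀ e.toModuleIso.inv).postcompOfLinear R M (add_zero i))
    (by
      ext x
      change (x.comp (Ext.mk₀ e.toModuleIso.inv) (add_zero i)).comp (Ext.mk₀ e.toModuleIso.hom)
        (add_zero i) = x
      rw [Ext.comp_assoc _ _ _ (add_zero i) (zero_add 0) (by lia), Ext.mk₀_comp_mk₀,
        Iso.inv_hom_id, Ext.comp_mk₀_id])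
    (by
      ext x
      change (x.comp (Ext.mk₀ e.toModuleIso.hom) (add_zero i)).comp (Ext.mk₀ e.toModuleIso.inv)
        (add_zero i) = x
      rw [Ext.comp_assoc _ _ _ (add_zero i) (zero_add 0) (by lia), Ext.mk₀_comp_mk₀,
        Iso.hom_inv_id, Ext.comp_mk₀_id])

/-- Homomorphisms from a cyclic module `R / I` are the elements annihilated by `I`. -/
lemma nonempty_quotient_hom_linearEquiv {R N W E : Type} [CommRing R] [AddCommGroup N] [Module R N]
    [AddCommGroup W] [Module R W] [AddCommGroup E] [Module R E] (I : Ideal R)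
    (f : N →ₗ[R] E) (hf : Function.Injective f) (g : W →ₗ[R] E) (hg : Function.Injective g)
    (h : ∀ x, x ∈ LinearMap.range g ↔ x ∈ LinearMap.range f ∧ ∀ r ∈ I, r • x = 0) :
    Nonempty (((R ⧸ I) →ₗ[R] N) ≃ₗ[R] W) := by
  let ev : ((R ⧸ I) →ₗ[R] N) →ₗ[R] E := f ∘ₗ LinearMap.applyₗ (1 : R ⧸ I)
  have hev : ∀ φ, ev φ = f (φ 1) := fun φ => rfl
  have hinj : Function.Injective ev := by
    intro φ ψ hφ
    have h1 : φ 1 = ψ 1 := hf hφ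
    refine LinearMap.ext fun x => ?_
    obtain ⟨r, rfl⟩ := Ideal.Quotient.mk_surjective x
    have h2 : Ideal.Quotient.mk I r = r • (1 : R ⧸ I) := by
      rw [Algebra.smul_def, mul_one]; rfl
    rw [h2, map_smul, map_smul, h1]
  have hrange : LinearMap.range ev = LinearMap.range g := by
    ext x
    rw [h]
    constructor
    · rintro ⟨φ, rfl⟩
      refine ⟨⟨_, rfl⟩, fun r hr => ?_⟩
      have h2 : r • (1 : R ⧸ I) = 0 := by
        rw [Algebra.smul_def, mul_one]
        exact Ideal.Quotient.eq_zero_iff_mem.2 hr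
      rw [hev, ← map_smul, ← map_smul, h2, map_zero, map_zero]
    · rintro ⟨⟨y, rfl⟩, hy⟩
      refine ⟨Submodule.liftQ I (LinearMap.toSpanSingleton R N y) fun r hr => ?_, ?_⟩
      · rw [LinearMap.mem_ker, LinearMap.toSpanSingleton_apply]
        exact hf (by rw [map_smul, hy r hr, map_zero])
      · rw [hev]
        congr 1
        change Submodule.liftQ I (LinearMap.toSpanSingleton R N y) _ (Submodule.Quotient.mk 1) = y
        rw [Submodule.liftQ_apply, LinearMap.toSpanSingleton_apply, one_smul]
  exact ⟨(LinearEquiv.ofInjective ev hinj).trans ((LinearEquiv.ofEq _ _ hrange).trans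
    (LinearEquiv.ofInjective g hg).symm)⟩

variable {K : Type} [Field K] {n : ℕ} {Δ : Finset (Finset (Fin n))}

/-- The canonical module of the Stanley–Reisner ring of a complex of dimension at most `k` is the
module of top-dimensional cycles with polynomial coefficients. -/
theorem nonempty_extMod_linearEquiv_ker_faceD (hΔ : IsSimplicialComplex Δ) (k i : ℕ)
    (hn : n = k + 1 + i) (hdim : ∀ s ∈ Δ, s.card ≤ k + 1) :
    Nonempty (extMod (MvPolynomial (Fin n) K) i
      (MvPolynomial (Fin n) K ⧸ stanleyReisnerIdeal K Δ) (MvPolynomial (Fin n) K)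
        ≃ₗ[MvPolynomial (Fin n) K] LinearMap.ker (faceD K Δ k)) := by
  obtain ⟨e⟩ := nonempty_linearEquiv_ker_cousinD (K := K) (n := n) (by lia)
  obtain rfl : i = n - (k + 1) := by lia
  obtain ⟨e'⟩ := nonempty_ext_ker_cousinD_linearEquiv (K := K) (n := n)
    (ModuleCat.of (MvPolynomial (Fin n) K) (MvPolynomial (Fin n) K ⧸ stanleyReisnerIdeal K Δ)) k
    (fun j i hj => subsingleton_ext_cousin j i fun F hF => by
      rw [Ideal.annihilator_quotient]
      refine Ideal.subset_span ⟨F, fun h => ?_, rfl⟩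
      have := hdim F h
      lia) (n - (k + 1)) (by lia)
  have hk : k + (n - (k + 1)) = n - 1 := by lia
  rw [hk] at e'
  obtain ⟨e''⟩ := nonempty_quotient_hom_linearEquiv (stanleyReisnerIdeal K Δ)
    (LinearMap.ker (cousinD K n k)).subtype (Submodule.injective_subtype _)
    (faceToCousin K Δ (k + 1) ∘ₗ (LinearMap.ker (faceD K Δ k)).subtype)
    ((faceToCousin_injective (k + 1)).comp (Submodule.injective_subtype _))
    (fun x => by
      rw [LinearMap.range_comp, Submodule.range_subtype, Submodule.range_subtype]
      exact map_ker_faceD hΔ hdim x)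
  exact ⟨(extModEquiv _ _ _ _).trans <| (extCongrRight _ e _).trans <| e'.trans <|
    Ext.linearEquiv₀.trans <| ModuleCat.homLinearEquiv.trans e''⟩

end CanonicalModule

section ElementarySymmetric

variable {K : Type} [Field K] {n : ℕ}

variable (K) in
/-- The substitution of a polynomial for a variable. -/
noncomputable def substVar (c : Fin n) (p : MvPolynomial (Fin n) K) :
    MvPolynomial (Fin n) K →ₐ[K] MvPolynomial (Fin n) K :=
  aeval (Function.update X c p)

lemma substVar_X_self (c : Fin n) (p : MvPolynomial (Fin n) K) : substVar K c p (X c) = p := by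
  rw [substVar, aeval_X, Function.update_self]

lemma substVar_X_of_ne {c i : Fin n} (h : i ≠ c) (p : MvPolynomial (Fin n) K) :
    substVar K c p (X i) = X i := by
  rw [substVar, aeval_X, Function.update_of_ne h]

lemma exists_eq_substVar_add (c : Fin n) (p f : MvPolynomial (Fin n) K) :
    ∃ g, f = substVar K c p f + (X c - p) * g := by
  induction f using MvPolynomial.induction_on with
  | C a => exact ⟨0, by simp [algHom_C]⟩
  | add f f' hf hf' =>
    obtain ⟨g, hg⟩ := hf
    obtain ⟨g', hg'⟩ := hf'
    exact ⟨g + g', by rw [map_add]; linear_combination hg + hg'⟩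
  | mul_X f i hf =>
    obtain ⟨g, hg⟩ := hf
    by_cases h : i = c
    · subst h
      refine ⟨X i * g + substVar K i p f, ?_⟩
      rw [map_mul, substVar_X_self]
      linear_combination X i * hg
    · refine ⟨X i * g, ?_⟩
      rw [map_mul, substVar_X_of_ne h]
      linear_combination X i * hg

lemma exists_eq_mul_of_pair {a b : Fin n} (hab : a ≠ b) {f g : MvPolynomial (Fin n) K}
    (h : X a * X b * f = (X a + X b) * g) : ∃ k, f = (X a + X b) * k := by
  have h1 := congrArg (substVar K b (-X a)) h
  simp only [map_mul, map_add, substVar_X_self, substVar_X_of_ne hab] at h1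
  have h2 : X a * X a * substVar K b (-X a) f = 0 := by linear_combination -h1
  have h3 : substVar K b (-X a) f = 0 :=
    (mul_eq_zero.1 h2).resolve_left (mul_ne_zero (X_ne_zero a) (X_ne_zero a))
  obtain ⟨k, hk⟩ := exists_eq_substVar_add b (-X a) f
  exact ⟨k, by rw [hk, h3]; ring⟩

lemma exists_eq_mul_of_triple {a b c : Fin n} (hab : a ≠ b) (hac : a ≠ c) (hbc : b ≠ c)
    {f g : MvPolynomial (Fin n) K}
    (h : (X a * X b + X a * X c + X b * X c) * f = (X a + X b + X c) * g) :
    ∃ k, f = (X a + X b + X c) * k := by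
  have h1 := congrArg (substVar K c (-X a - X b)) h
  simp only [map_mul, map_add, substVar_X_self, substVar_X_of_ne hac, substVar_X_of_ne hbc] at h1
  have h2 : (X a * X a + X a * X b + X b * X b) * substVar K c (-X a - X b) f = 0 := by
    linear_combination -h1
  have h3 : (X a * X a + X a * X b + X b * X b : MvPolynomial (Fin n) K) ≠ 0 := fun h => by
    have := congrArg (eval fun i => if i = a then (1 : K) else 0) h
    simp [hab.symm] at this
  have h4 := (mul_eq_zero.1 h2).resolve_left h3
  obtain ⟨k, hk⟩ := exists_eq_substVar_add c (-X a - X b) f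
  exact ⟨k, by rw [hk, h4]; ring⟩

lemma exists_eq_add_of_X_mul {a b c : Fin n} (hab : a ≠ b) (hac : a ≠ c) (hbc : b ≠ c)
    {f g h : MvPolynomial (Fin n) K}
    (hf : X a * f = (X a + X b + X c) * g + (X a * X b + X a * X c + X b * X c) * h) :
    ∃ g' h', f = (X a + X b + X c) * g' + (X a * X b + X a * X c + X b * X c) * h' := by
  obtain ⟨g', hg'⟩ := exists_eq_substVar_add a 0 g
  obtain ⟨h', hh'⟩ := exists_eq_substVar_add a 0 h
  have h1 := congrArg (substVar K a 0) hf
  simp only [map_mul, map_add, substVar_X_self, substVar_X_of_ne hab.symm,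
    substVar_X_of_ne hac.symm] at h1
  set u := substVar K a 0 g
  set v := substVar K a 0 h
  obtain ⟨k, hk⟩ : ∃ k, v = (X b + X c) * k :=
    exists_eq_mul_of_pair (g := -u) hbc (by linear_combination -h1)
  have hbc0 : (X b + X c : MvPolynomial (Fin n) K) ≠ 0 := fun h => by
    have := congrArg (eval fun i => if i = b then (1 : K) else 0) h
    simp [hbc.symm] at this
  have hu : u = -X b * X c * k := by
    refine mul_left_cancel₀ hbc0 ?_
    rw [hk] at h1
    linear_combination -h1
  refine ⟨g' + (X b + X c) * k, h' - k, mul_left_cancel₀ (X_ne_zero a) ?_⟩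
  rw [hf, hg', hh', hk, hu]
  ring

lemma exists_eq_add_of_triple {a b c : Fin n} (hab : a ≠ b) (hac : a ≠ c) (hbc : b ≠ c)
    {f g h : MvPolynomial (Fin n) K}
    (hf : X a * X b * X c * f =
      (X a + X b + X c) * g + (X a * X b + X a * X c + X b * X c) * h) :
    ∃ g' h', f = (X a + X b + X c) * g' + (X a * X b + X a * X c + X b * X c) * h' := by
  obtain ⟨g₁, h₁, e₁⟩ := exists_eq_add_of_X_mul (f := X b * X c * f) (g := g) (h := h) hab hac hbc
    (by linear_combination hf)
  obtain ⟨g₂, h₂, e₂⟩ := exists_eq_add_of_X_mul (f := X c * f) (g := g₁) (h := h₁) hab.symm hbc hac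
    (by linear_combination e₁)
  obtain ⟨g₃, h₃, e₃⟩ := exists_eq_add_of_X_mul (f := f) (g := g₂) (h := h₂) hac.symm hbc.symm hab
    (by linear_combination e₂)
  exact ⟨g₃, h₃, by linear_combination e₃⟩

lemma restrict_esymm (F : Finset (Fin n)) (k : ℕ) :
    restrict K F (esymm (Fin n) K k) = ∑ t ∈ F.powersetCard k, ∏ i ∈ t, X i := by
  rw [esymm, map_sum, ← Finset.sum_subset (Finset.powersetCard_mono (Finset.subset_univ F))]
  · refine Finset.sum_congr rfl fun t ht => restrict_prod_X_of_subset ?_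
    exact (Finset.mem_powersetCard.1 ht).1
  · intro t ht ht'
    refine restrict_prod_X_of_not_subset fun h => ht' ?_
    exact Finset.mem_powersetCard.2 ⟨h, (Finset.mem_powersetCard.1 ht).2⟩

lemma restrict_esymm_one_singleton (a : Fin n) :
    restrict K {a} (esymm (Fin n) K 1) = X a := by
  rw [restrict_esymm]
  simp [Finset.powersetCard_one]

lemma restrict_esymm_one_pair {a b : Fin n} (hab : a ≠ b) :
    restrict K {a, b} (esymm (Fin n) K 1) = X a + X b := by
  rw [restrict_esymm, Finset.powersetCard_one]
  simp [hab]

lemma restrict_esymm_two_pair {a b : Fin n} (hab : a ≠ b) :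
    restrict K {a, b} (esymm (Fin n) K 2) = X a * X b := by
  have h : ({a, b} : Finset (Fin n)).powersetCard 2 = {{a, b}} := by
    rw [← Finset.card_pair hab, Finset.powersetCard_self]
  rw [restrict_esymm, h, Finset.sum_singleton, Finset.prod_pair hab]

lemma restrict_esymm_one_triple {a b c : Fin n} (hab : a ≠ b) (hac : a ≠ c) (hbc : b ≠ c) :
    restrict K {a, b, c} (esymm (Fin n) K 1) = X a + X b + X c := by
  rw [restrict_esymm, Finset.powersetCard_one]
  simp [hab, hac, hbc, add_assoc]

lemma restrict_esymm_two_triple {a b c : Fin n} (hab : a ≠ b) (hac : a ≠ c) (hbc : b ≠ c) :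
    restrict K {a, b, c} (esymm (Fin n) K 2) = X a * X b + X a * X c + X b * X c := by
  have h : ({a, b, c} : Finset (Fin n)).powersetCard 2 = {{a, b}, {a, c}, {b, c}} := by
    have h' : ({b, c} : Finset (Fin n)).powersetCard 2 = {{b, c}} := by
      rw [← Finset.card_pair hbc, Finset.powersetCard_self]
    rw [Finset.powersetCard_succ_insert (by simp [hab, hac]), h', Finset.powersetCard_one]
    ext s
    simp
    tauto
  have h₁ : ({a, b} : Finset (Fin n)) ∉ ({{a, c}, {b, c}} : Finset (Finset (Fin n))) := fun h => by
    rcases Finset.mem_insert.1 h with h | h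
    · simpa [hab.symm, hbc] using congrArg (b ∈ ·) h
    · simpa [hab, hac] using congrArg (a ∈ ·) (Finset.mem_singleton.1 h)
  have h₂ : ({a, c} : Finset (Fin n)) ∉ ({{b, c}} : Finset (Finset (Fin n))) := fun h => by
    simpa [hab, hac] using congrArg (a ∈ ·) (Finset.mem_singleton.1 h)
  rw [restrict_esymm, h, Finset.sum_insert h₁, Finset.sum_insert h₂, Finset.sum_singleton,
    Finset.prod_pair hab, Finset.prod_pair hac, Finset.prod_pair hbc, add_assoc]

lemma restrict_esymm_three_triple {a b c : Fin n} (hab : a ≠ b) (hac : a ≠ c) (hbc : b ≠ c) :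
    restrict K {a, b, c} (esymm (Fin n) K 3) = X a * X b * X c := by
  have h : ({a, b, c} : Finset (Fin n)).powersetCard 3 = {{a, b, c}} := by
    rw [← Finset.card_eq_three.2 ⟨a, b, c, hab, hac, hbc, rfl⟩, Finset.powersetCard_self]
  rw [restrict_esymm, h, Finset.sum_singleton]
  simp [hab, hac, hbc, mul_assoc]

end ElementarySymmetric

section FaceRegular

variable {K : Type} [Field K] {n : ℕ}

lemma restrict_esymm_one_ne_zero {F : Finset (Fin n)} (hF : F.Nonempty) :
    restrict K F (esymm (Fin n) K 1) ≠ 0 := by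
  obtain ⟨a, ha⟩ := hF
  intro h
  have := congrArg (restrict K {a}) h
  rw [restrict_restrict_of_subset (Finset.singleton_subset_iff.2 ha), map_zero,
    restrict_esymm_one_singleton] at this
  exact X_ne_zero a this

lemma restrict_eq_zero_of_esymm_one_mul {F : Finset (Fin n)} (hF : F.Nonempty)
    {f : MvPolynomial (Fin n) K} (h : restrict K F (esymm (Fin n) K 1 * f) = 0) :
    restrict K F f = 0 := by
  rw [map_mul] at h
  exact (mul_eq_zero.1 h).resolve_left (restrict_esymm_one_ne_zero hF)

lemma exists_restrict_eq_esymm_one_mul {F : Finset (Fin n)} (hF : F.card = 2 ∨ F.card = 3)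
    {f g : MvPolynomial (Fin n) K}
    (h : restrict K F (esymm (Fin n) K 2 * f) = restrict K F (esymm (Fin n) K 1 * g)) :
    ∃ k, restrict K F f = restrict K F (esymm (Fin n) K 1 * k) := by
  rw [map_mul, map_mul] at h
  rcases hF with hF | hF
  · obtain ⟨a, b, hab, rfl⟩ := Finset.card_eq_two.1 hF
    rw [restrict_esymm_one_pair hab, restrict_esymm_two_pair hab] at h
    obtain ⟨k, hk⟩ := exists_eq_mul_of_pair hab h
    refine ⟨k, ?_⟩
    rw [← restrict_self, hk, map_mul, map_mul, restrict_esymm_one_pair hab,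
      ← restrict_esymm_one_pair hab, restrict_self]
  · obtain ⟨a, b, c, hab, hac, hbc, rfl⟩ := Finset.card_eq_three.1 hF
    rw [restrict_esymm_one_triple hab hac hbc, restrict_esymm_two_triple hab hac hbc] at h
    obtain ⟨k, hk⟩ := exists_eq_mul_of_triple hab hac hbc h
    refine ⟨k, ?_⟩
    rw [← restrict_self, hk, map_mul, map_mul, restrict_esymm_one_triple hab hac hbc,
      ← restrict_esymm_one_triple hab hac hbc, restrict_self]

lemma exists_restrict_eq_esymm_add {F : Finset (Fin n)} (hF : F.card = 3)
    {f g h : MvPolynomial (Fin n) K}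
    (hf : restrict K F (esymm (Fin n) K 3 * f) =
      restrict K F (esymm (Fin n) K 1 * g + esymm (Fin n) K 2 * h)) :
    ∃ p q, restrict K F f =
      restrict K F (esymm (Fin n) K 1 * p + esymm (Fin n) K 2 * q) := by
  obtain ⟨a, b, c, hab, hac, hbc, rfl⟩ := Finset.card_eq_three.1 hF
  rw [map_add, map_mul, map_mul, map_mul, restrict_esymm_one_triple hab hac hbc,
    restrict_esymm_two_triple hab hac hbc, restrict_esymm_three_triple hab hac hbc] at hf
  obtain ⟨p, q, hpq⟩ := exists_eq_add_of_triple hab hac hbc hf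
  refine ⟨p, q, ?_⟩
  rw [← restrict_self, hpq, ← restrict_esymm_one_triple hab hac hbc,
    ← restrict_esymm_two_triple hab hac hbc]
  simp only [map_add, map_mul, restrict_self]

variable {Δ : Finset (Finset (Fin n))}

lemma mkQ_faceKer_eq_iff {k : ℕ} {f g : Finset (Fin n) → MvPolynomial (Fin n) K} :
    (faceKer K Δ k).mkQ f = (faceKer K Δ k).mkQ g ↔
      ∀ F ∈ Δ, F.card = k → restrict K F (f F) = restrict K F (g F) := by
  rw [Submodule.mkQ_apply, Submodule.mkQ_apply, Submodule.Quotient.eq, mem_faceKer]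
  simp only [Pi.sub_apply, map_sub, sub_eq_zero]

lemma esymm_one_smul_eq_zero {k : ℕ} (hk : k ≠ 0) (x : faceModule K Δ k)
    (h : esymm (Fin n) K 1 • x = 0) : x = 0 := by
  obtain ⟨f, rfl⟩ := Submodule.mkQ_surjective _ x
  rw [← map_smul, ← map_zero (faceKer K Δ k).mkQ, mkQ_faceKer_eq_iff] at h
  rw [← map_zero (faceKer K Δ k).mkQ, mkQ_faceKer_eq_iff]
  intro F hF hFk
  rw [Pi.zero_apply, map_zero]
  refine restrict_eq_zero_of_esymm_one_mul (Finset.card_ne_zero.1 (by lia)) ?_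
  simpa using h F hF hFk

lemma exists_eq_esymm_one_smul {k : ℕ} (hk : k = 2 ∨ k = 3) (x y : faceModule K Δ k)
    (h : esymm (Fin n) K 2 • x = esymm (Fin n) K 1 • y) :
    ∃ z, x = esymm (Fin n) K 1 • z := by
  obtain ⟨f, rfl⟩ := Submodule.mkQ_surjective _ x
  obtain ⟨g, rfl⟩ := Submodule.mkQ_surjective _ y
  rw [← map_smul, ← map_smul, mkQ_faceKer_eq_iff] at h
  have h' : ∀ F, ∃ p, F ∈ Δ → F.card = k →
      restrict K F (f F) = restrict K F (esymm (Fin n) K 1 * p) := by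
    intro F
    by_cases hF : F ∈ Δ ∧ F.card = k
    · obtain ⟨p, hp⟩ := exists_restrict_eq_esymm_one_mul (by rwa [hF.2]) (h F hF.1 hF.2)
      exact ⟨p, fun _ _ => hp⟩
    · exact ⟨0, fun h1 h2 => absurd ⟨h1, h2⟩ hF⟩
  choose p hp using h'
  refine ⟨(faceKer K Δ k).mkQ p, ?_⟩
  rw [← map_smul, mkQ_faceKer_eq_iff]
  exact hp

lemma exists_eq_esymm_smul_add (x y y' : faceModule K Δ 3)
    (h : esymm (Fin n) K 3 • x = esymm (Fin n) K 1 • y + esymm (Fin n) K 2 • y') :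
    ∃ z z', x = esymm (Fin n) K 1 • z + esymm (Fin n) K 2 • z' := by
  obtain ⟨f, rfl⟩ := Submodule.mkQ_surjective _ x
  obtain ⟨g, rfl⟩ := Submodule.mkQ_surjective _ y
  obtain ⟨g', rfl⟩ := Submodule.mkQ_surjective _ y'
  rw [← map_smul, ← map_smul, ← map_smul, ← map_add, mkQ_faceKer_eq_iff] at h
  have h' : ∀ F, ∃ p q, F ∈ Δ → F.card = 3 → restrict K F (f F) =
      restrict K F (esymm (Fin n) K 1 * p + esymm (Fin n) K 2 * q) := by
    intro F
    by_cases hF : F ∈ Δ ∧ F.card = 3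
    · obtain ⟨p, q, hp⟩ := exists_restrict_eq_esymm_add hF.2 (h F hF.1 hF.2)
      exact ⟨p, q, fun _ _ => hp⟩
    · exact ⟨0, 0, fun h1 h2 => absurd ⟨h1, h2⟩ hF⟩
  choose p q hp using h'
  refine ⟨(faceKer K Δ 3).mkQ p, (faceKer K Δ 3).mkQ q, ?_⟩
  rw [← map_smul, ← map_smul, ← map_add, mkQ_faceKer_eq_iff]
  exact hp

end FaceRegular

section CycleModule

variable {R W V U : Type} [CommRing R] [AddCommGroup W] [Module R W] [AddCommGroup V] [Module R V]
  [AddCommGroup U] [Module R U]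

lemma isWeaklyRegular_triple {a b c : R} (h₁ : ∀ x : W, a • x = 0 → x = 0)
    (h₂ : ∀ x y : W, b • x = a • y → ∃ z, x = a • z)
    (h₃ : ∀ x y y' : W, c • x = a • y + b • y' → ∃ z z', x = a • z + b • z') :
    RingTheory.Sequence.IsWeaklyRegular W [a, b, c] := by
  have hI : ∀ r : R, ∀ x : W, x ∈ Ideal.span {r} • (⊤ : Submodule R W) ↔ ∃ y, x = r • y := by
    intro r x
    rw [Submodule.ideal_span_singleton_smul, Submodule.mem_smul_pointwise_iff_exists]
    simp [eq_comm]
  have key : ∀ (N : Submodule R W) (r : R), (∀ x, r • x ∈ N → x ∈ N) → IsSMulRegular (W ⧸ N) r := by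
    intro N r h
    refine isSMulRegular_iff_right_eq_zero_of_smul.2 fun x hx => ?_
    obtain ⟨x, rfl⟩ := Submodule.mkQ_surjective _ x
    exact (Submodule.Quotient.mk_eq_zero _).2 (h x ((Submodule.Quotient.mk_eq_zero _).1 hx))
  rw [RingTheory.Sequence.isWeaklyRegular_iff_Fin]
  intro i
  refine key _ _ ?_
  fin_cases i
  · intro x hx
    simp [Ideal.ofList] at hx ⊢
    exact h₁ x hx
  · intro x hx
    simp [Ideal.ofList_cons] at hx ⊢
    rw [hI] at hx ⊢
    obtain ⟨y, hy⟩ := hx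
    exact h₂ x y hy
  · intro x hx
    simp [Ideal.ofList_cons, Submodule.sup_smul] at hx ⊢
    rw [Submodule.mem_sup] at hx ⊢
    obtain ⟨y, hy, y', hy', h⟩ := hx
    rw [hI] at hy hy'
    obtain ⟨y, rfl⟩ := hy
    obtain ⟨y', rfl⟩ := hy'
    obtain ⟨z, z', rfl⟩ := h₃ x y y' h.symm
    exact ⟨_, (hI _ _).2 ⟨z, rfl⟩, _, (hI _ _).2 ⟨z', rfl⟩, rfl⟩

/-- A criterion for a sequence to be weakly regular on the kernel of the first map of a complex
`W → V → U`. -/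
theorem isWeaklyRegular_ker {a b c : R} (d : W →ₗ[R] V) (d' : V →ₗ[R] U)
    (hdd : ∀ x, d' (d x) = 0)
    (hW₁ : ∀ x : W, a • x = 0 → x = 0)
    (hW₂ : ∀ x y : W, b • x = a • y → ∃ z, x = a • z)
    (hW₃ : ∀ x y y' : W, c • x = a • y + b • y' → ∃ z z', x = a • z + b • z')
    (hV₁ : ∀ x : V, a • x = 0 → x = 0)
    (hV₂ : ∀ x y : V, b • x = a • y → ∃ z, x = a • z)
    (hU₁ : ∀ x : U, a • x = 0 → x = 0)
    (hH : ∀ x : V, d' x = 0 → ∀ y, d y = a • x → ∃ y, d y = x) :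
    RingTheory.Sequence.IsWeaklyRegular (LinearMap.ker d) [a, b, c] := by
  refine isWeaklyRegular_triple ?_ ?_ ?_
  · rintro ⟨x, hx⟩ h
    exact Subtype.ext (hW₁ x (Subtype.ext_iff.1 h))
  · rintro ⟨x, hx⟩ ⟨y, hy⟩ h
    obtain ⟨z, rfl⟩ := hW₂ x y (Subtype.ext_iff.1 h)
    exact ⟨⟨z, hV₁ _ (by rw [← map_smul]; exact hx)⟩, rfl⟩
  · rintro ⟨x, hx⟩ ⟨y, hy⟩ ⟨y', hy'⟩ h
    obtain ⟨z, z', rfl⟩ := hW₃ x y y' (Subtype.ext_iff.1 h)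
    rw [LinearMap.mem_ker, map_add, map_smul, map_smul] at hx
    obtain ⟨e, he⟩ := hV₂ (d z') (-d z) (by rw [smul_neg]; exact eq_neg_of_add_eq_zero_right hx)
    have he' : d z + b • e = 0 := hV₁ _ (by rw [← hx, he, smul_add, smul_comm])
    obtain ⟨t, rfl⟩ := hH e (hU₁ _ (by rw [← map_smul, ← he, hdd])) z' he
    refine ⟨⟨z + b • t, ?_⟩, ⟨z' - a • t, ?_⟩, Subtype.ext ?_⟩
    · rw [LinearMap.mem_ker, map_add, map_smul, he']
    · rw [LinearMap.mem_ker, map_sub, map_smul, he, sub_self]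
    · change a • z + b • z' = a • (z + b • t) + b • (z' - a • t)
      rw [smul_add, smul_sub, smul_comm a b t]
      abel

end CycleModule

section EdgeCycles

variable {K : Type} [Field K] {n : ℕ} {Δ : Finset (Finset (Fin n))}

lemma constantCoeff_restrict (F : Finset (Fin n)) (f : MvPolynomial (Fin n) K) :
    constantCoeff (restrict K F f) = constantCoeff f := by
  rw [constantCoeff_eq, coeff_restrict]
  exact if_pos fun _ _ => rfl

lemma restrict_empty (f : MvPolynomial (Fin n) K) : restrict K ∅ f = C (constantCoeff f) := by
  rw [restrict]
  simp only [Finset.notMem_empty, if_false]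
  rw [aeval_zero']
  rfl

lemma restrict_singleton_of_ne {v w : Fin n} (hvw : v ≠ w) {f : MvPolynomial (Fin n) K}
    (hf : restrict K {w} f = f) (h0 : constantCoeff f = 0) : restrict K {v} f = 0 := by
  rw [← hf, restrict_restrict, Finset.singleton_inter_of_notMem (by simpa using hvw),
    restrict_empty, h0, C_0]

lemma exists_restrict_pair_eq {v w : Fin n} (hvw : v ≠ w) {f : MvPolynomial (Fin n) K}
    (hv : restrict K {v} f = 0) (hw : restrict K {w} f = 0) :
    ∃ g, restrict K {v, w} f = X v * X w * g := by
  have key : ∀ {v w : Fin n}, v ≠ w → substVar K v 0 (restrict K {v, w} f) = restrict K {w} f := by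
    intro v w hvw
    rw [← AlgHom.comp_apply]
    congr 1
    refine MvPolynomial.algHom_ext fun i => ?_
    rw [AlgHom.comp_apply]
    by_cases hi : i = v
    · subst hi
      rw [restrict_X_of_mem (by simp), substVar_X_self, restrict_X_of_notMem (by simpa using hvw)]
    · by_cases hi' : i = w
      · subst hi'
        rw [restrict_X_of_mem (by simp), substVar_X_of_ne hi, restrict_X_of_mem (by simp)]
      · rw [restrict_X_of_notMem (by simp [hi, hi']), restrict_X_of_notMem (by simpa using hi'),
          map_zero]
  obtain ⟨p, hp⟩ := exists_eq_substVar_add v 0 (restrict K {v, w} f)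
  rw [key hvw, hw, zero_add, sub_zero] at hp
  obtain ⟨q, hq⟩ := exists_eq_substVar_add w 0 p
  have h := key hvw.symm
  rw [Finset.pair_comm, hp, hv, map_mul, substVar_X_of_ne hvw] at h
  rw [(mul_eq_zero.1 h).resolve_left (X_ne_zero v), zero_add, sub_zero] at hq
  exact ⟨q, by rw [hp, hq, mul_assoc]⟩

/-- For a polynomial `f` whose restriction to the axis `v` is `c₀ + c₁ X_v + c₂ X_v ^ 2 + ⋯`, this
is `c₂ X_v + c₃ X_v ^ 2 + ⋯`. -/
noncomputable def axisQuotient (v : Fin n) : MvPolynomial (Fin n) K →+ MvPolynomial (Fin n) K where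
  toFun f := restrict K {v} ((restrict K {v} f).divMonomial (Finsupp.single v 1)) -
    C (constantCoeff ((restrict K {v} f).divMonomial (Finsupp.single v 1)))
  map_zero' := by rw [map_zero, zero_divMonomial, map_zero, map_zero, C_0, sub_zero]
  map_add' f g := by
    rw [map_add, add_divMonomial, map_add, map_add, C_add]
    ring

lemma axisQuotient_apply (v : Fin n) (f : MvPolynomial (Fin n) K) :
    axisQuotient v f = restrict K {v} ((restrict K {v} f).divMonomial (Finsupp.single v 1)) -
      C (constantCoeff ((restrict K {v} f).divMonomial (Finsupp.single v 1))) := rfl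

lemma restrict_axisQuotient (v : Fin n) (f : MvPolynomial (Fin n) K) :
    restrict K {v} (axisQuotient v f) = axisQuotient v f := by
  rw [axisQuotient_apply, map_sub, restrict_self, algHom_C, algebraMap_eq]

lemma constantCoeff_axisQuotient (v : Fin n) (f : MvPolynomial (Fin n) K) :
    constantCoeff (axisQuotient v f) = 0 := by
  rw [axisQuotient_apply, map_sub, constantCoeff_restrict, constantCoeff_C, sub_self]

lemma axisQuotient_eq {v : Fin n} {f g : MvPolynomial (Fin n) K}
    (h : restrict K {v} f = X v * restrict K {v} g) (h0 : constantCoeff g = 0) :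
    axisQuotient v f = restrict K {v} g := by
  rw [axisQuotient_apply, h, X_mul_divMonomial, restrict_self, constantCoeff_restrict, h0, C_0,
    sub_zero]

lemma restrict_sum_axisQuotient {v : Fin n} {F : Finset (Fin n)} (hv : v ∈ F)
    (f : MvPolynomial (Fin n) K) :
    restrict K {v} (∑ w ∈ F, axisQuotient w f) = axisQuotient v f := by
  rw [map_sum, Finset.sum_eq_single_of_mem v hv fun w _ hw => restrict_singleton_of_ne hw.symm
    (restrict_axisQuotient w f) (constantCoeff_axisQuotient w f), restrict_axisQuotient]

lemma simpBoundary_constantCoeff (k : ℕ) (f : Finset (Fin n) → MvPolynomial (Fin n) K)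
    (s : {s : Finset (Fin n) // s ∈ Δ ∧ s.card = k + 1}) :
    simpBoundary K Δ k (fun s => constantCoeff (f s)) s =
      constantCoeff (faceBoundary K Δ f s) := by
  rw [faceBoundary_apply, map_sum constantCoeff]
  change (∑ v : Fin n, if h : v ∉ s.1 ∧ insert v s.1 ∈ Δ ∧ (insert v s.1).card = k + 1 + 1
    then (-1 : K) ^ (s.1.filter (fun i => i < v)).card * constantCoeff (f (insert v s.1))
    else 0) = _
  refine Finset.sum_congr rfl fun v _ => ?_
  by_cases h : v ∉ s.1 ∧ insert v s.1 ∈ Δ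
  · rw [dif_pos ⟨h.1, h.2, by rw [Finset.card_insert_of_notMem h.1, s.2.2]⟩, if_pos h, insertSign,
      zsmul_eq_mul, map_mul]
    congr 1
    simp
  · rw [dif_neg fun h' => h ⟨h'.1, h'.2.1⟩, if_neg h, map_zero]

/-- The constant terms of a family on edges can be removed by a boundary if `H₁(Δ; K) = 0`. -/
lemma exists_constantCoeff_faceBoundary_eq (hH1 : Subsingleton (simpHomologySucc K Δ 0))
    {f : Finset (Fin n) → MvPolynomial (Fin n) K} (hf : faceBoundary K Δ f ∈ faceKer K Δ 1) :
    ∃ g : Finset (Fin n) → MvPolynomial (Fin n) K, ∀ F ∈ Δ, F.card = 2 →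
      constantCoeff (faceBoundary K Δ g F) = constantCoeff (f F) := by
  have hc : (fun s => constantCoeff (f s) : simpChains K Δ 1) ∈
      LinearMap.ker (simpBoundary K Δ 0) := by
    refine LinearMap.mem_ker.2 (funext fun s => ?_)
    rw [simpBoundary_constantCoeff, ← constantCoeff_restrict, hf _ s.2.1 s.2.2, map_zero]
    rfl
  have h0 : (Submodule.Quotient.mk ⟨_, hc⟩ : simpHomologySucc K Δ 0) = 0 := Subsingleton.elim _ _
  obtain ⟨b, hb⟩ := (Submodule.Quotient.mk_eq_zero _).1 h0
  refine ⟨fun F => if h : F ∈ Δ ∧ F.card = 3 then C (b ⟨F, h⟩) else 0, fun F hF hF2 => ?_⟩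
  rw [← simpBoundary_constantCoeff 1 _ ⟨F, hF, hF2⟩]
  refine Eq.trans ?_ (congrFun hb ⟨F, hF, hF2⟩)
  exact congrArg (fun c => simpBoundary K Δ 1 c ⟨F, hF, hF2⟩)
    (funext fun s => by rw [dif_pos s.2, constantCoeff_C])

lemma restrict_faceBoundary_single {F : Finset (Fin n)} {u : Fin n} (hu : u ∉ F)
    (hF : insert u F ∈ Δ) (p : MvPolynomial (Fin n) K) {G : Finset (Fin n)}
    (hG : G.card = F.card) :
    restrict K G (faceBoundary K Δ (Pi.single (insert u F)
      (insertSign u F • ((∏ i ∈ F, X i) * p))) G) =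
        if G = F then restrict K F ((∏ i ∈ F, X i) * p) else 0 := by
  rw [faceBoundary_apply]
  split_ifs with h
  · subst h
    rw [Finset.sum_eq_single u, if_pos ⟨hu, hF⟩, Pi.single_eq_same, smul_smul,
      insertSign_mul_self, one_smul]
    · intro v _ hv
      split_ifs with h
      · rw [Pi.single_eq_of_ne, smul_zero]
        intro h'
        have := h' ▸ Finset.mem_insert_self v G
        exact (Finset.mem_insert.1 this).elim hv h.1
      · rfl
    · simp
  · rw [map_sum]
    refine Finset.sum_eq_zero fun v _ => ?_
    split_ifs with h'
    · by_cases h2 : insert v G = insert u F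
      · rw [h2, Pi.single_eq_same, map_zsmul, map_zsmul, map_mul, restrict_prod_X_of_not_subset,
          zero_mul, smul_zero, smul_zero]
        exact fun h3 => h (Finset.eq_of_subset_of_card_le h3 hG.le).symm
      · rw [Pi.single_eq_of_ne h2, smul_zero, map_zero]
    · exact map_zero _

/-- A family on edges which vanishes on the axes of every edge, and on every edge which lies in no
triangle, is a boundary. -/
lemma exists_restrict_faceBoundary_eq {h : Finset (Fin n) → MvPolynomial (Fin n) K}
    (h₁ : ∀ F ∈ Δ, F.card = 2 → ∀ v ∈ F, restrict K {v} (h F) = 0)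
    (h₂ : ∀ F ∈ Δ, F.card = 2 → (∀ v, v ∉ F → insert v F ∉ Δ) → restrict K F (h F) = 0) :
    ∃ w : Finset (Fin n) → MvPolynomial (Fin n) K, ∀ F ∈ Δ, F.card = 2 →
      restrict K F (faceBoundary K Δ w F) = restrict K F (h F) := by
  have key : ∀ F, ∃ w : Finset (Fin n) → MvPolynomial (Fin n) K, F ∈ Δ → F.card = 2 →
      ∀ G : Finset (Fin n), G.card = 2 →
        restrict K G (faceBoundary K Δ w G) = if G = F then restrict K F (h F) else 0 := by
    intro F
    by_cases hF : F ∈ Δ ∧ F.card = 2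
    · by_cases hu : ∃ u, u ∉ F ∧ insert u F ∈ Δ
      · obtain ⟨u, hu, huF⟩ := hu
        obtain ⟨p, hp⟩ : ∃ p, restrict K F (h F) = (∏ i ∈ F, X i) * p := by
          have h' := h₁ F hF.1 hF.2
          obtain ⟨v, w, hvw, rfl⟩ := Finset.card_eq_two.1 hF.2
          rw [Finset.prod_pair hvw]
          exact exists_restrict_pair_eq hvw (h' v (by simp)) (h' w (by simp))
        refine ⟨Pi.single (insert u F) (insertSign u F • ((∏ i ∈ F, X i) * p)),
          fun _ _ G hG => ?_⟩
        rw [restrict_faceBoundary_single hu huF p (hG.trans hF.2.symm), ← hp, restrict_self]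
      · push Not at hu
        refine ⟨0, fun _ _ G _ => ?_⟩
        rw [h₂ F hF.1 hF.2 hu, ite_self, map_zero, Pi.zero_apply, map_zero]
    · exact ⟨0, fun h1 h2 => absurd ⟨h1, h2⟩ hF⟩
  choose w hw using key
  refine ⟨∑ F ∈ Δ with F.card = 2, w F, fun G hG hG2 => ?_⟩
  rw [map_sum, Finset.sum_apply, map_sum, Finset.sum_eq_single_of_mem G (by simp [hG, hG2]),
    hw G hG hG2 G hG2, if_pos rfl]
  intro F hF hFG
  rw [Finset.mem_filter] at hF
  rw [hw F hF.1 hF.2 G hG2, if_neg hFG.symm]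

/-- If `H₁(Δ; K) = 0`, the linear form `∑ X_i` acts injectively on the first homology of the complex
of face modules. -/
theorem exists_faceD_eq_of_esymm_one_smul
    (hH1 : Subsingleton (simpHomologySucc K Δ 0)) (x : faceModule K Δ 2)
    (hx : faceD K Δ 1 x = 0) (y : faceModule K Δ 3)
    (hxy : faceD K Δ 2 y = esymm (Fin n) K 1 • x) : ∃ y, faceD K Δ 2 y = x := by
  obtain ⟨h, rfl⟩ := Submodule.mkQ_surjective _ x
  obtain ⟨f, rfl⟩ := Submodule.mkQ_surjective _ y
  obtain ⟨g, hg⟩ := exists_constantCoeff_faceBoundary_eq hH1 (mkQ_mem_ker_faceD.1 hx)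
  rw [faceD_mk, ← map_smul, mkQ_faceKer_eq_iff] at hxy
  set h' := h - faceBoundary K Δ g with hh'
  set f' := f - esymm (Fin n) K 1 • g with hf'
  have e1 : ∀ F ∈ Δ, F.card = 2 → constantCoeff (h' F) = 0 := fun F hF hF2 => by
    rw [hh', Pi.sub_apply, map_sub, hg F hF hF2, sub_self]
  have e2 : ∀ F ∈ Δ, F.card = 2 → restrict K F (faceBoundary K Δ f' F) =
      restrict K F (esymm (Fin n) K 1 * h' F) := fun F hF hF2 => by
    rw [hf', hh', map_sub, map_smul, Pi.sub_apply, Pi.sub_apply, mul_sub, map_sub, map_sub,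
      hxy F hF hF2]
    rfl
  let q : Finset (Fin n) → MvPolynomial (Fin n) K := fun F => ∑ v ∈ F, axisQuotient v (f' F)
  have e5 : ∀ F ∈ Δ, F.card = 2 → ∀ v ∈ F,
      restrict K {v} ((h' - faceBoundary K Δ q) F) = 0 := by
    intro F hF hF2 v hv
    have e3 : restrict K {v} (faceBoundary K Δ f' F) = X v * restrict K {v} (h' F) := by
      have := congrArg (restrict K {v}) (e2 F hF hF2)
      rwa [restrict_restrict_of_subset (by simpa using hv), restrict_restrict_of_subset
        (by simpa using hv), map_mul, restrict_esymm_one_singleton] at this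
    rw [Pi.sub_apply, map_sub, ← axisQuotient_eq e3 (e1 F hF hF2), sub_eq_zero, faceBoundary_apply,
      faceBoundary_apply, map_sum, map_sum]
    refine Finset.sum_congr rfl fun u _ => ?_
    split_ifs
    · rw [map_zsmul, map_zsmul, restrict_sum_axisQuotient (Finset.mem_insert_of_mem hv)]
    · rw [map_zero, map_zero]
  have e6 : ∀ F ∈ Δ, F.card = 2 → (∀ v, v ∉ F → insert v F ∉ Δ) →
      restrict K F ((h' - faceBoundary K Δ q) F) = 0 := by
    intro F hF hF2 hu
    have e3 : ∀ f : Finset (Fin n) → MvPolynomial (Fin n) K, faceBoundary K Δ f F = 0 := fun f => by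
      rw [faceBoundary_apply]
      exact Finset.sum_eq_zero fun v _ => if_neg fun h => hu v h.1 h.2
    have e4 := e2 F hF hF2
    rw [e3, map_zero] at e4
    rw [Pi.sub_apply, e3, sub_zero]
    exact restrict_eq_zero_of_esymm_one_mul (Finset.card_pos.1 (by lia)) e4.symm
  obtain ⟨w, hw⟩ := exists_restrict_faceBoundary_eq e5 e6
  refine ⟨(faceKer K Δ 3).mkQ (g + q + w), ?_⟩
  rw [faceD_mk, mkQ_faceKer_eq_iff]
  intro F hF hF2
  rw [map_add, map_add, Pi.add_apply, Pi.add_apply, map_add, hw F hF hF2, Pi.sub_apply, hh',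
    Pi.sub_apply, ← map_add]
  congr 1
  abel

end EdgeCycles

section RegularSequences

open RingTheory.Sequence

lemma length_le_supportDim {R : Type} [CommRing R] (rs : List R) :
    ∀ (M : Type) [AddCommGroup M] [Module R M] [Module.Finite R M], IsRegular M rs →
      (rs.length : WithBot ℕ∞) ≤ Module.supportDim R M := by
  induction rs with
  | nil =>
    intro M _ _ _ h
    have := h.nontrivial
    have := (Module.nonempty_support_of_nontrivial (R := R) (M := M)).to_subtype
    exact Order.krullDim_nonneg
  | cons r rs ih =>
    intro M _ _ _ h
    rw [isRegular_cons_iff] at h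
    refine le_trans ?_ (Module.supportDim_quotSMulTop_succ_le_of_notMem_minimalPrimes (x := r)
      fun p hp => h.1.notMem_of_mem_minimalPrimes hp)
    rw [List.length_cons, Nat.cast_succ]
    gcongr
    exact ih _ h.2

lemma isCMMod_of_isRegular {R : Type} [CommRing R] {I : Ideal R} {M : Type} [AddCommGroup M]
    [Module R M] [Module.Finite R M] {rs : List R} (hrs : IsRegular M rs) (hI : ∀ r ∈ rs, r ∈ I)
    (hdim : Module.supportDim R M ≤ rs.length) : IsCMMod I M := by
  have h1 : moduleDim R M = (rs.length : WithBot ℕ∞) := by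
    refine (Module.supportDim_eq_ringKrullDim_quotient_annihilator R M).symm.trans ?_
    exact le_antisymm hdim (length_le_supportDim rs M hrs)
  have h2 : moduleDepth I M = (rs.length : ℕ∞) := by
    refine le_antisymm (sSup_le (α := ℕ∞) ?_) (le_sSup (α := ℕ∞) ⟨rs, rfl, hI, hrs⟩)
    rintro _ ⟨ss, rfl, -, hss⟩
    exact WithBot.coe_le_coe.1 ((length_le_supportDim ss M hss).trans hdim)
  rw [IsCMMod, h1, h2]
  rfl

lemma IsCMMod.of_linearEquiv {R : Type} [CommRing R] {I : Ideal R} {M N : Type} [AddCommGroup M]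
    [Module R M] [AddCommGroup N] [Module R N] (h : IsCMMod I N) (e : M ≃ₗ[R] N) :
    IsCMMod I M := by
  rw [IsCMMod, moduleDim, moduleDepth] at h ⊢
  rw [e.annihilator_eq]
  simpa only [e.isRegular_congr] using h

end RegularSequences

section FaceDimension

variable {K : Type} [Field K] {n : ℕ} {Δ : Finset (Finset (Fin n))}

lemma ringKrullDim_quotient_ker_restrict_le (F : Finset (Fin n)) :
    ringKrullDim (MvPolynomial (Fin n) K ⧸ RingHom.ker (restrict K F)) ≤ F.card := by
  have h : Function.Surjective ((Ideal.Quotient.mk (RingHom.ker (restrict K F))).comp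
      (rename ((↑) : F → Fin n)).toRingHom) := by
    intro x
    obtain ⟨f, rfl⟩ := Ideal.Quotient.mk_surjective x
    refine ⟨aeval (fun i => if h : i ∈ F then X ⟨i, h⟩ else 0) f, ?_⟩
    have h : rename ((↑) : F → Fin n) (aeval (fun i => if h : i ∈ F then X ⟨i, h⟩ else 0) f) =
        restrict K F f := by
      rw [← AlgHom.comp_apply]
      congr 1
      refine MvPolynomial.algHom_ext fun i => ?_
      rw [AlgHom.comp_apply, aeval_X]
      by_cases hi : i ∈ F
      · rw [dif_pos hi, rename_X, restrict_X_of_mem hi]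
      · rw [dif_neg hi, map_zero, restrict_X_of_notMem hi]
    refine Ideal.Quotient.eq.2 ?_
    change restrict K F (rename ((↑) : F → Fin n) (aeval _ f) - f) = 0
    rw [h, map_sub, restrict_self, sub_self]
  refine (ringKrullDim_le_of_surjective _ h).trans ?_
  rw [MvPolynomial.ringKrullDim_of_isNoetherianRing, ringKrullDim_eq_zero_of_field, zero_add,
    Nat.card_eq_fintype_card, Fintype.card_coe]

lemma supportDim_faceModule_le (k : ℕ) :
    Module.supportDim (MvPolynomial (Fin n) K) (faceModule K Δ k) ≤ k := by
  have key : ∀ p ∈ Module.support (MvPolynomial (Fin n) K) (faceModule K Δ k),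
      ∃ F : Finset (Fin n), F.card = k ∧ RingHom.ker (restrict K F) ≤ p.asIdeal := by
    intro p hp
    rw [Module.support_eq_zeroLocus, PrimeSpectrum.mem_zeroLocus] at hp
    have h : ∏ F ∈ Δ with F.card = k, RingHom.ker (restrict K F) ≤
        Module.annihilator (MvPolynomial (Fin n) K) (faceModule K Δ k) := by
      refine Ideal.prod_le_inf.trans fun r hr => Module.mem_annihilator.2 fun x => ?_
      obtain ⟨f, rfl⟩ := Submodule.mkQ_surjective _ x
      rw [← map_smul, ← map_zero (faceKer K Δ k).mkQ, mkQ_faceKer_eq_iff]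
      intro F hF hFk
      have := (Submodule.mem_finsetInf).1 hr F (by simp [hF, hFk])
      rw [Pi.smul_apply, smul_eq_mul, map_mul, RingHom.mem_ker.1 this, zero_mul, Pi.zero_apply,
        map_zero]
    obtain ⟨F, hF, h'⟩ := p.isPrime.prod_le.1 (h.trans hp)
    exact ⟨F, (Finset.mem_filter.1 hF).2, h'⟩
  refine iSup_le fun s => ?_
  obtain ⟨F, hFk, hF⟩ := key _ s.head.2
  have h := ringKrullDim_quotient_ker_restrict_le (K := K) F
  rw [ringKrullDim_quotient, hFk] at h
  refine le_trans ?_ h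
  have hs : ∀ i, (s i).1 ∈ PrimeSpectrum.zeroLocus
      (RingHom.ker (restrict K F) : Set (MvPolynomial (Fin n) K)) := fun i =>
    hF.trans (LTSeries.head_le s i)
  exact Order.LTSeries.length_le_krullDim ⟨s.length, fun i => ⟨(s i).1, hs i⟩, s.step⟩

lemma esymm_mem_maxIdeal {k : ℕ} (hk : k ≠ 0) : esymm (Fin n) K k ∈ maxIdeal K n := by
  refine Ideal.sum_mem _ fun t ht => ?_
  obtain ⟨i, hi⟩ := Finset.card_ne_zero.1 ((Finset.mem_powersetCard.1 ht).2.trans_ne hk)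
  exact Ideal.mem_of_dvd _ (Finset.dvd_prod_of_mem _ hi) (Ideal.subset_span ⟨i, rfl⟩)

lemma constantCoeff_eq_zero_of_mem_maxIdeal {f : MvPolynomial (Fin n) K} (hf : f ∈ maxIdeal K n) :
    constantCoeff f = 0 := by
  have h : maxIdeal K n ≤ RingHom.ker (constantCoeff (R := K) (σ := Fin n)) :=
    Ideal.span_le.2 (by rintro _ ⟨i, rfl⟩; exact constantCoeff_X _ i)
  exact h hf

/-- The product of the vertices of a top-dimensional face is a cycle. -/
lemma mkQ_single_mem_ker_faceD {k : ℕ} {F : Finset (Fin n)} (hF : F.card = k + 1) :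
    (faceKer K Δ (k + 1)).mkQ (Pi.single F (∏ i ∈ F, X i)) ∈ LinearMap.ker (faceD K Δ k) := by
  rw [mkQ_mem_ker_faceD]
  intro G _ hGk
  rw [faceBoundary_apply, map_sum]
  refine Finset.sum_eq_zero fun v _ => ?_
  split_ifs
  · rw [map_zsmul]
    by_cases h : insert v G = F
    · rw [h, Pi.single_eq_same, restrict_prod_X_of_not_subset, smul_zero]
      intro h'
      have := Finset.card_le_card h'
      lia
    · rw [Pi.single_eq_of_ne h, map_zero, smul_zero]
  · exact map_zero _

lemma top_ne_smul_ker_faceD {k : ℕ} {F : Finset (Fin n)} (hFΔ : F ∈ Δ) (hF : F.card = k + 1)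
    {I : Ideal (MvPolynomial (Fin n) K)} (hI : I ≤ maxIdeal K n) :
    (⊤ : Submodule (MvPolynomial (Fin n) K) (LinearMap.ker (faceD K Δ k))) ≠ I • ⊤ := by
  intro h
  obtain ⟨r, hr, hr'⟩ := Submodule.exists_sub_one_mem_and_smul_eq_zero_of_fg_of_le_smul I _
    (IsNoetherian.noetherian _) h.le
  have h1 := congrArg Subtype.val (hr' ⟨_, mkQ_single_mem_ker_faceD (Δ := Δ) hF⟩ trivial)
  change r • (faceKer K Δ (k + 1)).mkQ (Pi.single F (∏ i ∈ F, X i)) = 0 at h1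
  rw [← map_smul, ← map_zero (faceKer K Δ (k + 1)).mkQ, mkQ_faceKer_eq_iff] at h1
  have h2 := h1 F hFΔ hF
  rw [Pi.smul_apply, Pi.single_eq_same, smul_eq_mul, map_mul, Pi.zero_apply, map_zero,
    restrict_prod_X_of_subset subset_rfl] at h2
  have h3 := (mul_eq_zero.1 h2).resolve_right
    (Finset.prod_ne_zero_iff.2 fun i _ => X_ne_zero i)
  have h4 := constantCoeff_restrict F r
  have h5 := constantCoeff_eq_zero_of_mem_maxIdeal (hI hr)
  rw [h3, map_zero] at h4
  rw [map_sub, ← h4, map_one, zero_sub] at h5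
  exact one_ne_zero (neg_eq_zero.1 h5)

/-- If `H₁(Δ; K) = 0`, the module of two-dimensional cycles with polynomial coefficients is
Cohen–Macaulay. -/
theorem isCMMod_ker_faceD (hΔ : IsSimplicialComplex Δ) (hdim : ∃ s ∈ Δ, s.card = 3)
    (hH1 : Subsingleton (simpHomologySucc K Δ 0)) :
    IsCMMod (maxIdeal K n) (LinearMap.ker (faceD K Δ 2)) := by
  have hmem : ∀ r ∈ [esymm (Fin n) K 1, esymm (Fin n) K 2, esymm (Fin n) K 3],
      r ∈ maxIdeal K n := by
    simp only [List.mem_cons, List.not_mem_nil, or_false]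
    rintro r (rfl | rfl | rfl) <;> exact esymm_mem_maxIdeal (by simp)
  obtain ⟨F, hFΔ, hF⟩ := hdim
  refine isCMMod_of_isRegular ⟨isWeaklyRegular_ker (faceD K Δ 2) (faceD K Δ 1) (faceD_faceD hΔ 1)
    (esymm_one_smul_eq_zero (by simp)) (exists_eq_esymm_one_smul (Or.inr rfl))
    exists_eq_esymm_smul_add (esymm_one_smul_eq_zero (by simp))
    (exists_eq_esymm_one_smul (Or.inl rfl)) (esymm_one_smul_eq_zero (by simp))
    (exists_faceD_eq_of_esymm_one_smul hH1), ?_⟩ hmem ?_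
  · exact top_ne_smul_ker_faceD hFΔ hF (Ideal.span_le.2 hmem)
  · exact (Module.supportDim_le_of_injective _ (Submodule.injective_subtype _)).trans
      (supportDim_faceModule_le 3)

end FaceDimension

/-- Let `Δ` be a 2-dimensional simplicial complex on `[n]` with `H₁(Δ; K) = 0`.  Then the
Stanley–Reisner ring `K[Δ] = R/I_Δ` is canonically Cohen–Macaulay, i.e.
`Ext^{n−3}_R(K[Δ], ω_R)` is a Cohen–Macaulay `R`-module. -/
theorem stanley_reisner_ccm_of_H1_vanishing
    (K : Type) [Field K] (n : ℕ) (Δ : Finset (Finset (Fin n)))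
    (hΔ : IsSimplicialComplex Δ)
    (hdim : (∀ s ∈ Δ, s.card ≤ 3) ∧ ∃ s ∈ Δ, s.card = 3)
    (hH1 : Subsingleton (simpHomologySucc K Δ 0)) :
    IsCMMod (maxIdeal K n)
      (extMod (MvPolynomial (Fin n) K) (n - 3)
        (MvPolynomial (Fin n) K ⧸ stanleyReisnerIdeal K Δ) (MvPolynomial (Fin n) K)) := by
  obtain ⟨s, hs, hs3⟩ := hdim.2
  have hn : n = 2 + 1 + (n - 3) := by
    have := s.card_le_univ
    rw [Fintype.card_fin] at this
    lia
  obtain ⟨e⟩ := nonempty_extMod_linearEquiv_ker_faceD (K := K) hΔ 2 (n - 3) hn hdim.1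
  exact (isCMMod_ker_faceD hΔ hdim.2 hH1).of_linearEquiv e
end
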